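/- arXiv:1407.5287 — 5 statements merged into one kernel-verified Lean document; each statement's English description precedes it below -/
import Mathlib

section
/- Let β > 0 and let γ be a real number with γ ∉ {0, −1, −2, …}. Let α_k = (−1)^k binom(β,k). Then there exists a constant C > 0 such that for every integer n ≥ 1, |∑_{k=1}^{n} α_{n−k} k^{γ−1}| ≤ C (n^{γ−1−β} + n^{−β−1}). -/
/-- The generalized binomial coefficient `binom(β,k) = β(β−1)⋯(β−k+1)/k!`. -/
noncomputable def gbinom (β : ℝ) (k : ℕ) : ℝ :=
  (∏ i ∈ Finset.range k, (β - i)) / (Nat.factorial k)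

/-- The coefficients of the power series of `(1 - z) ^ β`. -/
noncomputable def oneSubPowCoeff (β : ℝ) (k : ℕ) : ℝ := (-1) ^ k * gbinom β k

/-- Symbols of order `s`: each forward difference gains one power of decay on `[1, ∞)`. -/
def IsSymbol (s : ℝ) (f : ℝ → ℝ) : Prop :=
  ∀ i : ℕ, ∃ C, 0 ≤ C ∧ ∀ x : ℝ, 1 ≤ x → |(fwdDiff 1)^[i] f x| ≤ C * x ^ (s - i)

theorem rpow_le_two_rpow_abs_mul {x y : ℝ} (p : ℝ) (hx : 0 < x) (hy : 0 < y) (hxy : x ≤ 2 * y)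
    (hyx : y ≤ 2 * x) : x ^ p ≤ 2 ^ |p| * y ^ p := by
  rcases le_total 0 p with hp | hp
  · rw [abs_of_nonneg hp, ← Real.mul_rpow (by norm_num) hy.le]
    exact Real.rpow_le_rpow hx.le hxy hp
  · rw [abs_of_nonpos hp, Real.rpow_neg (by norm_num), ← Real.inv_rpow (by norm_num),
      ← Real.mul_rpow (by norm_num) hy.le]
    exact Real.rpow_le_rpow_of_nonpos (by positivity) (by linarith) hp

theorem oneSubPowCoeff_zero (β : ℝ) : oneSubPowCoeff β 0 = 1 := by
  simp [oneSubPowCoeff, gbinom]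

theorem oneSubPowCoeff_succ (β : ℝ) (k : ℕ) :
    oneSubPowCoeff β (k + 1) = oneSubPowCoeff β k * ((k - β) / (k + 1)) := by
  have h : (k : ℝ) + 1 ≠ 0 := by positivity
  have h' : (k.factorial : ℝ) ≠ 0 := by positivity
  simp only [oneSubPowCoeff, gbinom, Finset.prod_range_succ, Nat.factorial_succ, pow_succ]
  push_cast
  field_simp
  ring

theorem oneSubPowCoeff_succ' (β : ℝ) (k : ℕ) :
    oneSubPowCoeff β (k + 1) = -β / (k + 1) * oneSubPowCoeff (β - 1) k := by
  have h : (k : ℝ) + 1 ≠ 0 := by positivity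
  have h' : (k.factorial : ℝ) ≠ 0 := by positivity
  have hp : ∏ i ∈ Finset.range k, (β - ((i + 1 : ℕ) : ℝ)) = ∏ i ∈ Finset.range k, (β - 1 - i) :=
    Finset.prod_congr rfl fun i _ => by push_cast; ring
  simp only [oneSubPowCoeff, gbinom, Finset.prod_range_succ', Nat.factorial_succ, pow_succ, hp]
  push_cast
  field_simp
  ring

theorem oneSubPowCoeff_succ_eq_sub (β : ℝ) (k : ℕ) :
    oneSubPowCoeff β (k + 1) = oneSubPowCoeff (β - 1) (k + 1) - oneSubPowCoeff (β - 1) k := by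
  have h : (k : ℝ) + 1 ≠ 0 := by positivity
  rw [oneSubPowCoeff_succ', oneSubPowCoeff_succ]
  field_simp
  ring

theorem exists_abs_oneSubPowCoeff_le (β : ℝ) :
    ∃ C, 0 ≤ C ∧ ∀ j : ℕ, |oneSubPowCoeff β j| ≤ C * ((j : ℝ) + 1) ^ (-β - 1) := by
  set p := β + 1 with hp
  let d : ℕ → ℝ := fun j => |oneSubPowCoeff β j| * Real.exp (p * (harmonic j : ℝ))
  have hd0 : ∀ j, 0 ≤ d j := fun j => by positivity
  obtain ⟨N, hN⟩ := exists_nat_ge p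
  have hstep : ∀ j, N ≤ j → d (j + 1) ≤ d j := by
    intro j hj
    have hj' : (N : ℝ) ≤ j := by exact_mod_cast hj
    have hpos : (0 : ℝ) < j + 1 := by positivity
    have hq : |((j : ℝ) - β) / (j + 1)| ≤ Real.exp (-(p / (j + 1))) := by
      have : ((j : ℝ) - β) / (j + 1) = -(p / (j + 1)) + 1 := by
        field_simp
        ring
      rw [abs_of_nonneg (div_nonneg (by linarith) hpos.le), this]
      exact Real.add_one_le_exp _
    simp only [d]
    rw [oneSubPowCoeff_succ, harmonic_succ, abs_mul]
    push_cast
    calc _ ≤ |oneSubPowCoeff β j| * Real.exp (-(p / (j + 1))) *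
          Real.exp (p * ((harmonic j : ℝ) + ((j : ℝ) + 1)⁻¹)) := by gcongr
      _ = _ := by
        rw [mul_assoc, ← Real.exp_add]
        congr 2
        ring
  have hbound : ∀ j, d j ≤ ∑ i ∈ Finset.range (N + 1), d i := by
    intro j
    rcases le_total j N with h | h
    · exact Finset.single_le_sum (fun i _ => hd0 i) (Finset.mem_range.2 (by omega))
    · induction j, h using Nat.le_induction with
      | base => exact Finset.single_le_sum (fun i _ => hd0 i) (Finset.mem_range.2 (by omega))
      | succ j hj ih => exact (hstep j hj).trans ih
  have hexp : ∀ j : ℕ, Real.exp (-(p * (harmonic j : ℝ))) ≤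
      Real.exp |p| * ((j : ℝ) + 1) ^ (-β - 1) := by
    intro j
    have hpos : (0 : ℝ) < j + 1 := by positivity
    rw [Real.rpow_def_of_pos hpos, ← Real.exp_add]
    apply Real.exp_le_exp.2
    have h1 : Real.log ((j : ℝ) + 1) ≤ harmonic j := by exact_mod_cast log_add_one_le_harmonic j
    have h2 : (harmonic j : ℝ) ≤ 1 + Real.log ((j : ℝ) + 1) := by
      refine (harmonic_le_one_add_log j).trans ?_
      rcases Nat.eq_zero_or_pos j with rfl | h
      · simp
      · gcongr
        linarith
    have h3 : -β - 1 = -p := by rw [hp]; ring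
    rw [h3]
    rcases le_total 0 p with h | h
    · rw [abs_of_nonneg h]
      nlinarith
    · rw [abs_of_nonpos h]
      nlinarith
  refine ⟨(∑ i ∈ Finset.range (N + 1), d i) * Real.exp |p|,
    mul_nonneg (Finset.sum_nonneg fun i _ => hd0 i) (Real.exp_nonneg _), fun j => ?_⟩
  have : |oneSubPowCoeff β j| = d j * Real.exp (-(p * (harmonic j : ℝ))) := by
    simp only [d]
    rw [mul_assoc, ← Real.exp_add]
    simp
  rw [this]
  exact (mul_le_mul (hbound j) (hexp j) (Real.exp_nonneg _)
    (Finset.sum_nonneg fun i _ => hd0 i)).trans_eq (mul_assoc _ _ _).symm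

theorem exists_sum_rpow_le {q : ℝ} (hq : 0 < q) :
    ∃ C, 0 ≤ C ∧ ∀ n : ℕ, ∑ j ∈ Finset.range n, ((j : ℝ) + 1) ^ (q - 1) ≤ C * (n : ℝ) ^ q := by
  rcases le_total q 1 with h1 | h1
  · refine ⟨q⁻¹, by positivity, fun n => ?_⟩
    induction n with
    | zero => simp [Real.zero_rpow hq.ne']
    | succ n ih =>
      have hpos : (0 : ℝ) < n + 1 := by positivity
      have hb := rpow_one_add_le_one_add_mul_self (s := -(1 / ((n : ℝ) + 1))) (p := q)
        (by rw [neg_le_neg_iff, div_le_one hpos]; linarith [(Nat.cast_nonneg n : (0 : ℝ) ≤ n)])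
        hq.le h1
      have he : 1 + -(1 / ((n : ℝ) + 1)) = n / (n + 1) := by
        field_simp
        ring
      rw [he, Real.div_rpow (by positivity) hpos.le, div_le_iff₀ (by positivity)] at hb
      have hs : ((n : ℝ) + 1) ^ (q - 1) = ((n : ℝ) + 1) ^ q / (n + 1) := by
        rw [Real.rpow_sub hpos, Real.rpow_one]
      have hs' : ((n : ℝ) + 1) ^ (q - 1) ≤ q⁻¹ * (((n : ℝ) + 1) ^ q - (n : ℝ) ^ q) := by
        rw [hs, le_inv_mul_iff₀ hq]
        have : (1 + q * -(1 / ((n : ℝ) + 1))) * ((n : ℝ) + 1) ^ q =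
          ((n : ℝ) + 1) ^ q - q * (((n : ℝ) + 1) ^ q / (n + 1)) := by ring
        linarith
      rw [Finset.sum_range_succ]
      push_cast
      linarith
  · refine ⟨1, zero_le_one, fun n => ?_⟩
    rcases Nat.eq_zero_or_pos n with rfl | hn
    · simp [Real.zero_rpow hq.ne']
    have hn' : (0 : ℝ) < n := by exact_mod_cast hn
    calc ∑ j ∈ Finset.range n, ((j : ℝ) + 1) ^ (q - 1)
        ≤ ∑ j ∈ Finset.range n, (n : ℝ) ^ (q - 1) := by
          refine Finset.sum_le_sum fun j hj => Real.rpow_le_rpow (by positivity) ?_ (by linarith)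
          exact_mod_cast Finset.mem_range.1 hj
      _ = 1 * (n : ℝ) ^ q := by
          rw [Finset.sum_const, Finset.card_range, nsmul_eq_mul, Real.rpow_sub hn', Real.rpow_one]
          field_simp

theorem exists_sum_rpow_le_add_one {q : ℝ} (hq : q ≠ 0) :
    ∃ C, 0 ≤ C ∧
      ∀ n : ℕ, ∑ j ∈ Finset.range n, ((j : ℝ) + 1) ^ (q - 1) ≤ C * ((n : ℝ) ^ q + 1) := by
  rcases hq.lt_or_gt with h | h
  · have hs : Summable fun j : ℕ => ((j : ℝ) + 1) ^ (q - 1) := by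
      have := (summable_nat_add_iff 1).2 (Real.summable_nat_rpow.2 (by linarith : q - 1 < -1))
      simpa using this
    have h0 : 0 ≤ ∑' j : ℕ, ((j : ℝ) + 1) ^ (q - 1) := tsum_nonneg fun j => by positivity
    refine ⟨∑' j : ℕ, ((j : ℝ) + 1) ^ (q - 1), h0, fun n => ?_⟩
    refine (hs.sum_le_tsum _ fun j _ => by positivity).trans ?_
    exact le_mul_of_one_le_right h0 (by linarith [Real.rpow_nonneg (Nat.cast_nonneg (α := ℝ) n) q])
  · obtain ⟨C, hC, H⟩ := exists_sum_rpow_le h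
    exact ⟨C, hC, fun n => (H n).trans (by gcongr; linarith)⟩

theorem IsSymbol.fwdDiff {s : ℝ} {f : ℝ → ℝ} (hf : IsSymbol s f) :
    IsSymbol (s - 1) (fwdDiff 1 f) := by
  intro i
  obtain ⟨C, hC, H⟩ := hf (i + 1)
  refine ⟨C, hC, fun x hx => ?_⟩
  have := H x hx
  rw [Function.iterate_succ_apply] at this
  convert this using 3
  push_cast
  ring

theorem hasDerivAt_fwdDiff_iterate_rpow (s : ℝ) (i : ℕ) {x : ℝ} (hx : 0 < x) :
    HasDerivAt ((fwdDiff 1)^[i] fun y : ℝ => y ^ s)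
      (s * (fwdDiff 1)^[i] (fun y : ℝ => y ^ (s - 1)) x) x := by
  induction i generalizing x with
  | zero => exact Real.hasDerivAt_rpow_const (Or.inl hx.ne')
  | succ i ih =>
    simp only [Function.iterate_succ_apply']
    have h := ((ih (x := x + 1) (by linarith)).comp_add_const x 1).sub (ih hx)
    rw [← mul_sub] at h
    exact h

theorem isSymbol_rpow (s : ℝ) : IsSymbol s fun x => x ^ s := by
  intro i
  induction i generalizing s with
  | zero =>
    refine ⟨1, zero_le_one, fun x hx => ?_⟩
    have : 0 ≤ x ^ s := by positivity
    simp [abs_of_nonneg this]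
  | succ i ih =>
    obtain ⟨C, hC, H⟩ := ih (s - 1)
    refine ⟨|s| * (C * 2 ^ |s - 1 - i|), by positivity, fun x hx => ?_⟩
    obtain ⟨c, hc, he⟩ := exists_hasDerivAt_eq_slope ((_root_.fwdDiff 1)^[i] fun y : ℝ => y ^ s) _
      (lt_add_one x)
      (fun y hy => (hasDerivAt_fwdDiff_iterate_rpow s i
        (by linarith [hy.1] : (0 : ℝ) < y)).continuousAt.continuousWithinAt)
      (fun y hy => hasDerivAt_fwdDiff_iterate_rpow s i (by linarith [hy.1] : (0 : ℝ) < y))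
    have he' : (_root_.fwdDiff 1)^[i + 1] (fun y : ℝ => y ^ s) x =
        s * (_root_.fwdDiff 1)^[i] (fun y : ℝ => y ^ (s - 1)) c := by
      rw [he, Function.iterate_succ_apply']
      simp [_root_.fwdDiff]
    rw [he', abs_mul, mul_assoc, mul_assoc]
    gcongr
    refine (H c (by linarith [hc.1])).trans ?_
    gcongr
    have : s - ((i + 1 : ℕ) : ℝ) = s - 1 - i := by push_cast; ring
    rw [this]
    exact rpow_le_two_rpow_abs_mul _ (by linarith [hc.1]) (by linarith) (by linarith [hc.2])
      (by linarith [hc.1])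

theorem sum_oneSubPowCoeff_mul_succ (β : ℝ) (g : ℕ → ℝ) (J : ℕ) :
    ∑ j ∈ Finset.range (J + 1), oneSubPowCoeff β j * g j =
      ∑ j ∈ Finset.range J, oneSubPowCoeff (β - 1) j * (g j - g (j + 1)) +
        oneSubPowCoeff (β - 1) J * g J := by
  induction J with
  | zero => simp [oneSubPowCoeff_zero]
  | succ J ih =>
    rw [Finset.sum_range_succ, ih, Finset.sum_range_succ _ J, oneSubPowCoeff_succ_eq_sub]
    ring

theorem IsSymbol.exists_abs_le_of_near {s : ℝ} {f : ℝ → ℝ} (hf : IsSymbol s f) :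
    ∃ C, 0 ≤ C ∧ ∀ (x : ℝ) (j J : ℕ), 1 ≤ x → 2 * J ≤ x → j ≤ J → |f (x - j)| ≤ C * x ^ s := by
  obtain ⟨C, hC, H⟩ := hf 0
  refine ⟨C * 2 ^ |s|, by positivity, fun x j J hx hJ hj => ?_⟩
  have hj' : (j : ℝ) ≤ J := by exact_mod_cast hj
  have h1 : 1 ≤ x - j := by
    rcases Nat.eq_zero_or_pos j with rfl | h
    · simpa
    · have : (1 : ℝ) ≤ j := by exact_mod_cast h
      linarith
  have := H (x - j) h1
  simp only [Function.iterate_zero, id, Nat.cast_zero, sub_zero] at this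
  refine this.trans ?_
  rw [mul_assoc]
  gcongr
  exact rpow_le_two_rpow_abs_mul _ (by linarith) (by linarith)
    (by linarith [(Nat.cast_nonneg j : (0 : ℝ) ≤ j)]) (by linarith)

/-- Repeated summation by parts controls the part of the convolution close to the endpoint. -/
theorem exists_abs_sum_oneSubPowCoeff_mul_le (m : ℕ) : ∀ {β s : ℝ} {f : ℝ → ℝ}, β < m →
    IsSymbol s f → ∃ C, 0 ≤ C ∧ ∀ (x : ℝ) (J : ℕ), 1 ≤ x → 2 * J ≤ x →
      |∑ j ∈ Finset.range (J + 1), oneSubPowCoeff β j * f (x - j)| ≤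
        C * (x ^ s * ((J : ℝ) + 1) ^ (-β)) := by
  induction m with
  | zero =>
    intro β s f hβ hf
    obtain ⟨A, hA, HA⟩ := exists_abs_oneSubPowCoeff_le β
    obtain ⟨B, hB, HB⟩ := hf.exists_abs_le_of_near
    obtain ⟨D, hD, HD⟩ := exists_sum_rpow_le (q := -β) (by simpa using hβ)
    refine ⟨A * B * D, by positivity, fun x J hx hJ => ?_⟩
    have hx0 : 0 ≤ x ^ s := by positivity
    calc _ ≤ ∑ j ∈ Finset.range (J + 1), |oneSubPowCoeff β j * f (x - j)| :=
          Finset.abs_sum_le_sum_abs _ _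
      _ ≤ ∑ j ∈ Finset.range (J + 1), A * ((j : ℝ) + 1) ^ (-β - 1) * (B * x ^ s) := by
          refine Finset.sum_le_sum fun j hj => ?_
          rw [abs_mul]
          exact mul_le_mul (HA j) (HB x j J hx hJ (by simpa [Nat.lt_succ_iff] using hj))
            (abs_nonneg _) (by positivity)
      _ = A * B * x ^ s * ∑ j ∈ Finset.range (J + 1), ((j : ℝ) + 1) ^ (-β - 1) := by
          rw [Finset.mul_sum]
          exact Finset.sum_congr rfl fun j _ => by ring
      _ ≤ A * B * x ^ s * (D * ((J + 1 : ℕ) : ℝ) ^ (-β)) := by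
          gcongr
          exact HD (J + 1)
      _ = _ := by push_cast; ring
  | succ m ih =>
    intro β s f hβ hf
    obtain ⟨A, hA, HA⟩ := exists_abs_oneSubPowCoeff_le (β - 1)
    obtain ⟨B, hB, HB⟩ := hf.exists_abs_le_of_near
    obtain ⟨D, hD, HD⟩ := ih (β := β - 1) (by push_cast at hβ; linarith) hf.fwdDiff
    refine ⟨D * (2 ^ |s - 1| * 2 ^ |-β|) + A * B, by positivity, fun x J hx hJ => ?_⟩
    have hx0 : 0 < x := by linarith
    rw [sum_oneSubPowCoeff_mul_succ β (fun j => f (x - j)) J, add_mul]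
    refine (abs_add_le _ _).trans (add_le_add ?_ ?_)
    · rcases J with _ | J
      · simp only [Finset.range_zero, Finset.sum_empty, abs_zero]
        positivity
      push_cast at hJ ⊢
      have hJ0 : (0 : ℝ) ≤ J := Nat.cast_nonneg J
      have hsum : ∑ j ∈ Finset.range (J + 1), oneSubPowCoeff (β - 1) j *
          (f (x - j) - f (x - (j + 1))) =
          ∑ j ∈ Finset.range (J + 1), oneSubPowCoeff (β - 1) j *
            _root_.fwdDiff 1 f (x - 1 - j) := by
        refine Finset.sum_congr rfl fun j _ => ?_
        rw [_root_.fwdDiff]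
        congr 3 <;> ring
      rw [hsum]
      refine (HD (x - 1) J (by linarith) (by linarith)).trans ?_
      rw [mul_assoc]
      refine mul_le_mul_of_nonneg_left ?_ hD
      have h1 : (x - 1) ^ (s - 1) ≤ 2 ^ |s - 1| * x ^ (s - 1) :=
        rpow_le_two_rpow_abs_mul _ (by linarith) hx0 (by linarith) (by linarith)
      have h2 : ((J : ℝ) + 1) ^ (-β) ≤ 2 ^ |-β| * ((J : ℝ) + 1 + 1) ^ (-β) :=
        rpow_le_two_rpow_abs_mul _ (by linarith) (by linarith) (by linarith) (by linarith)
      have h3 : ((J : ℝ) + 1) ^ (-(β - 1)) ≤ x * (2 ^ |-β| * ((J : ℝ) + 1 + 1) ^ (-β)) := by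
        have : -(β - 1) = 1 + -β := by ring
        rw [this, Real.rpow_add (by linarith), Real.rpow_one]
        exact mul_le_mul (by linarith) h2 (by positivity) hx0.le
      calc _ ≤ 2 ^ |s - 1| * x ^ (s - 1) * (x * (2 ^ |-β| * ((J : ℝ) + 1 + 1) ^ (-β))) :=
            mul_le_mul h1 h3 (by positivity) (by positivity)
        _ = _ := by
            rw [Real.rpow_sub hx0, Real.rpow_one]
            field_simp
    · rw [abs_mul]
      refine (mul_le_mul (HA J) (HB x J J hx hJ le_rfl) (abs_nonneg _) (by positivity)).trans_eq ?_
      have : -(β - 1) - 1 = -β := by ring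
      rw [this]
      ring

/-- For `β > 0`, `γ ∉ {0, −1, −2, …}` and `α_k = (−1)^k binom(β,k)`,
there is `C > 0` with `|∑_{k=1}^n α_{n−k} k^{γ−1}| ≤ C (n^{γ−1−β} + n^{−β−1})` for all `n ≥ 1`. -/
theorem stmt_1 (β γ : ℝ) (hβ : 0 < β) (hγ : ∀ m : ℕ, γ ≠ -(m : ℝ)) :
    ∃ C > 0, ∀ n : ℕ, 1 ≤ n →
      |∑ k ∈ Finset.Icc 1 n, (-1 : ℝ) ^ (n - k) * gbinom β (n - k) * (k : ℝ) ^ (γ - 1)| ≤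
        C * ((n : ℝ) ^ (γ - 1 - β) + (n : ℝ) ^ (-β - 1)) := by
  have hγ0 : γ ≠ 0 := by simpa using hγ 0
  obtain ⟨m, hm⟩ := exists_nat_gt β
  obtain ⟨A, hA, HA⟩ := exists_abs_oneSubPowCoeff_le β
  obtain ⟨B, hB, HB⟩ := exists_abs_sum_oneSubPowCoeff_mul_le m hm (isSymbol_rpow (γ - 1))
  obtain ⟨D, hD, HD⟩ := exists_sum_rpow_le_add_one hγ0
  refine ⟨B * 2 ^ |-β| + A * 2 ^ |-β - 1| * D + 1, by positivity, fun n hn => ?_⟩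
  have hn' : (1 : ℝ) ≤ n := by exact_mod_cast hn
  have hn0 : (0 : ℝ) < n := by linarith
  have hJ : 2 * ((n / 2 : ℕ) : ℝ) ≤ n := by exact_mod_cast (by omega : 2 * (n / 2) ≤ n)
  have hJ' : (n : ℝ) ≤ 2 * (((n / 2 : ℕ) : ℝ) + 1) := by
    exact_mod_cast (by omega : n ≤ 2 * (n / 2 + 1))
  have hreindex :
      ∑ k ∈ Finset.Icc 1 n, (-1 : ℝ) ^ (n - k) * gbinom β (n - k) * (k : ℝ) ^ (γ - 1) =
      ∑ j ∈ Finset.range n, oneSubPowCoeff β j * ((n : ℝ) - j) ^ (γ - 1) := by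
    refine Finset.sum_nbij' (fun k => n - k) (fun j => n - j) ?_ ?_ ?_ ?_ ?_
    · intro k hk; simp at hk ⊢; omega
    · intro k hk; simp at hk ⊢; omega
    · intro k hk; simp at hk ⊢; omega
    · intro k hk; simp at hk ⊢; omega
    · intro k hk
      rw [Finset.mem_Icc] at hk
      rw [Nat.cast_sub hk.2, sub_sub_cancel, oneSubPowCoeff]
  rw [hreindex, ← Finset.sum_range_add_sum_Ico _ (by omega : n / 2 + 1 ≤ n)]
  have hnear : |∑ j ∈ Finset.range (n / 2 + 1), oneSubPowCoeff β j * ((n : ℝ) - j) ^ (γ - 1)| ≤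
      B * 2 ^ |-β| * (n : ℝ) ^ (γ - 1 - β) := by
    refine (HB n (n / 2) hn' hJ).trans ?_
    have := rpow_le_two_rpow_abs_mul (x := ((n / 2 : ℕ) : ℝ) + 1) (y := n) (-β) (by positivity)
      hn0 (by linarith) hJ'
    rw [sub_eq_add_neg (γ - 1) β, Real.rpow_add hn0]
    calc _ ≤ B * ((n : ℝ) ^ (γ - 1) * (2 ^ |-β| * (n : ℝ) ^ (-β))) := by gcongr
      _ = _ := by ring
  have hfar : |∑ j ∈ Finset.Ico (n / 2 + 1) n, oneSubPowCoeff β j * ((n : ℝ) - j) ^ (γ - 1)| ≤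
      A * 2 ^ |-β - 1| * D * ((n : ℝ) ^ (γ - 1 - β) + (n : ℝ) ^ (-β - 1)) := by
    calc _ ≤ ∑ j ∈ Finset.Ico (n / 2 + 1) n, |oneSubPowCoeff β j * ((n : ℝ) - j) ^ (γ - 1)| :=
          Finset.abs_sum_le_sum_abs _ _
      _ ≤ ∑ j ∈ Finset.Ico (n / 2 + 1) n,
          A * (2 ^ |-β - 1| * (n : ℝ) ^ (-β - 1)) * ((n : ℝ) - j) ^ (γ - 1) := by
          refine Finset.sum_le_sum fun j hj => ?_
          rw [Finset.mem_Ico] at hj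
          have hj1 : ((n / 2 : ℕ) : ℝ) + 1 ≤ j := by exact_mod_cast hj.1
          have hj2 : (j : ℝ) + 1 ≤ n := by exact_mod_cast hj.2
          have hj0 : 0 ≤ (n : ℝ) - j := by linarith
          rw [abs_mul, abs_of_nonneg (Real.rpow_nonneg hj0 _)]
          gcongr
          refine (HA j).trans ?_
          gcongr
          exact rpow_le_two_rpow_abs_mul _ (by positivity) hn0 (by linarith) (by linarith)
      _ ≤ ∑ j ∈ Finset.range n,
          A * (2 ^ |-β - 1| * (n : ℝ) ^ (-β - 1)) * ((n : ℝ) - j) ^ (γ - 1) := by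
          refine Finset.sum_le_sum_of_subset_of_nonneg ?_ fun j hj _ => ?_
          · intro j hj; simp at hj ⊢; omega
          · have hj2 : (j : ℝ) + 1 ≤ n := by exact_mod_cast Finset.mem_range.1 hj
            have hj0 : 0 ≤ (n : ℝ) - j := by linarith
            positivity
      _ = A * (2 ^ |-β - 1| * (n : ℝ) ^ (-β - 1)) *
          ∑ j ∈ Finset.range n, ((j : ℝ) + 1) ^ (γ - 1) := by
          rw [← Finset.mul_sum, ← Finset.sum_range_reflect]
          congr 1
          refine Finset.sum_congr rfl fun j hj => ?_
          have hj' := Finset.mem_range.1 hj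
          rw [Nat.cast_sub (by omega), Nat.cast_sub hn]
          congr 1
          push_cast
          ring
      _ ≤ A * (2 ^ |-β - 1| * (n : ℝ) ^ (-β - 1)) * (D * ((n : ℝ) ^ γ + 1)) := by
          gcongr
          exact HD n
      _ = _ := by
          have : γ - 1 - β = (-β - 1) + γ := by ring
          rw [this, Real.rpow_add hn0]
          ring
  have h1 : 0 ≤ (n : ℝ) ^ (γ - 1 - β) := by positivity
  have h2 : 0 ≤ (n : ℝ) ^ (-β - 1) := by positivity
  have h3 : B * 2 ^ |-β| * (n : ℝ) ^ (γ - 1 - β) ≤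
      B * 2 ^ |-β| * ((n : ℝ) ^ (γ - 1 - β) + (n : ℝ) ^ (-β - 1)) := by
    gcongr
    linarith
  refine (abs_add_le _ _).trans ?_
  linarith
end

section
/- Let 1 < β < 2, α_k = (−1)^k binom(β,k) and θ_k = 2^{−β} binom(β,k). Define A_n = (1/Γ(β+1)) ∑_{k=0}^{n} α_{n−k} k^{β} − ∑_{k=0}^{n} θ_{n−k}. Then there exists a constant C > 0 such that |A_n| ≤ C n^{−1} for all integers n ≥ 1. -/
open Filter Topology Asymptotics

theorem gbinom_zero (β : ℝ) : gbinom β 0 = 1 := by simp [gbinom]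

theorem gbinom_succ (β : ℝ) (k : ℕ) :
    gbinom β (k + 1) * (k + 1) = gbinom β k * (β - k) := by
  have h1 : (k.factorial : ℝ) ≠ 0 := by exact_mod_cast k.factorial_ne_zero
  have h2 : (k : ℝ) + 1 ≠ 0 := by positivity
  simp only [gbinom, Finset.prod_range_succ, Nat.factorial_succ]
  push_cast
  field_simp

theorem gbinom_eq_choose (β : ℝ) (k : ℕ) : gbinom β k = Ring.choose β k := by
  induction k with
  | zero => simp [gbinom_zero]
  | succ k ih =>
    have h2 : (k : ℝ) + 1 ≠ 0 := by positivity
    have h := Ring.choose_add_smul_choose (β - k) k 1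
    have h1 := Ring.choose_smul_choose β (n := k + 1) (k := k) (by omega)
    simp only [Nat.choose_succ_self_right, nsmul_eq_mul, add_tsub_cancel_left,
      Ring.choose_one_right] at h1
    push_cast at h1
    apply mul_right_cancel₀ h2
    rw [gbinom_succ, ih, mul_comm (Ring.choose β (k + 1)), h1]

/-- The Taylor coefficients of `(1 - z) ^ (-s)`. -/
noncomputable def risingCoeff (s : ℝ) (k : ℕ) : ℝ := (-1) ^ k * gbinom (-s) k

theorem risingCoeff_succ (s : ℝ) (k : ℕ) :
    risingCoeff s (k + 1) * (k + 1) = risingCoeff s k * (s + k) := by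
  have h := gbinom_succ (-s) k
  simp only [risingCoeff, pow_succ]
  linear_combination (-1) ^ k * (-1) * h

theorem risingCoeff_add_one (s : ℝ) (k : ℕ) :
    risingCoeff (s + 1) k * s = risingCoeff s k * (s + k) := by
  induction k with
  | zero => simp [risingCoeff, gbinom_zero]
  | succ k ih =>
    have h2 : (k : ℝ) + 1 ≠ 0 := by positivity
    have h := risingCoeff_succ s k
    have h' := risingCoeff_succ (s + 1) k
    apply mul_right_cancel₀ h2
    push_cast
    linear_combination s * h' + (s + 1 + k) * ih - (s + k + 1) * h

theorem risingCoeff_pos {s : ℝ} (hs : 0 < s) (k : ℕ) : 0 < risingCoeff s k := by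
  induction k with
  | zero => simp [risingCoeff, gbinom_zero]
  | succ k ih =>
    have h2 : (0 : ℝ) < (k : ℝ) + 1 := by positivity
    have h : 0 < risingCoeff s k * (s + k) := by positivity
    rw [← risingCoeff_succ] at h
    exact pos_of_mul_pos_left h h2.le

theorem sum_gbinom_mul_risingCoeff (β s : ℝ) (n : ℕ) :
    ∑ k ∈ Finset.range (n + 1), (-1 : ℝ) ^ (n - k) * gbinom β (n - k) * risingCoeff s k
      = (-1) ^ n * gbinom (β - s) n := by
  have h := Ring.add_choose_eq (r := -s) (s := β) n (Commute.all _ _)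
  rw [Finset.Nat.sum_antidiagonal_eq_sum_range_succ_mk] at h
  rw [gbinom_eq_choose, show β - s = -s + β by ring, h, Finset.mul_sum]
  refine Finset.sum_congr rfl fun k hk => ?_
  have hk : k ≤ n := by simpa [Nat.lt_succ_iff] using hk
  have : (-1 : ℝ) ^ n = (-1) ^ (n - k) * (-1) ^ k := by rw [← pow_add]; congr 1; omega
  rw [this, risingCoeff, gbinom_eq_choose, gbinom_eq_choose]
  ring

theorem gbinom_neg_one (n : ℕ) : gbinom (-1) n = (-1) ^ n := by
  induction n with
  | zero => simp [gbinom_zero]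
  | succ k ih =>
    have h2 : (k : ℝ) + 1 ≠ 0 := by positivity
    apply mul_right_cancel₀ h2
    rw [gbinom_succ, ih]; ring

theorem gbinom_natCast_of_lt {m n : ℕ} (h : m < n) : gbinom m n = 0 := by
  rw [gbinom, Finset.prod_eq_zero (Finset.mem_range.2 h) (by simp), zero_div]

theorem abs_gbinom_le {β : ℝ} (hβ1 : 1 < β) (hβ2 : β < 2) :
    ∃ C, 0 ≤ C ∧ ∀ k : ℕ, |gbinom β k| * (k : ℝ) ^ 2 ≤ C := by
  have key : ∀ k : ℕ, 2 ≤ k → |gbinom β k| * (k : ℝ) ^ 2 ≤ |gbinom β 2| * 4 := by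
    intro k hk
    induction k, hk using Nat.le_induction with
    | base => norm_num
    | succ k hk ih =>
      have hk' : (2 : ℝ) ≤ k := by exact_mod_cast hk
      refine le_trans ?_ ih
      have h := congrArg abs (gbinom_succ β k)
      rw [abs_mul, abs_mul, abs_of_pos (by positivity : (0 : ℝ) < k + 1),
        abs_of_neg (by linarith : β - k < 0)] at h
      push_cast
      calc |gbinom β (k + 1)| * ((k : ℝ) + 1) ^ 2
          = |gbinom β k| * ((k - β) * (k + 1)) := by linear_combination (k + 1) * h
        _ ≤ _ := by
          apply mul_le_mul_of_nonneg_left _ (abs_nonneg _)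
          nlinarith
  refine ⟨|gbinom β 2| * 4 + |gbinom β 1|, by positivity, fun k => ?_⟩
  match k with
  | 0 => simp; positivity
  | 1 => simp
  | k + 2 => exact (key (k + 2) (by omega)).trans (by linarith [abs_nonneg (gbinom β 1)])

theorem abs_le_of_tendsto_zero_of_abs_sub_le {f g : ℕ → ℝ} {N : ℕ}
    (hf : Tendsto f atTop (𝓝 0)) (hg : ∀ k, 0 ≤ g k)
    (h : ∀ k ≥ N, |f (k + 1) - f k| ≤ g k - g (k + 1)) : ∀ k ≥ N, |f k| ≤ g k := by
  intro k hk
  have h1 : ∀ j, |f (k + j) - f k| ≤ g k - g (k + j) := by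
    intro j
    induction j with
    | zero => simp
    | succ j ih =>
      have := h (k + j) (by omega)
      have h3 := abs_sub_le (f (k + j + 1)) (f (k + j)) (f k)
      rw [← add_assoc]
      linarith
  have h2 : Tendsto (fun j => |f (k + j) - f k|) atTop (𝓝 |0 - f k|) := by
    have : Tendsto (fun j => f (k + j)) atTop (𝓝 0) := by
      simpa [add_comm] using (tendsto_add_atTop_iff_nat k).2 hf
    exact (this.sub_const _).abs
  have := le_of_tendsto' h2 fun j => (h1 j).trans (by linarith [hg (k + j)] : _ ≤ g k)
  simpa using this

theorem mul_abs_sum_convolution_le {a r : ℕ → ℝ} {A R : ℝ} (ha : Summable fun k => |a k|)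
    (hr : Summable fun k => |r k|) (hA : ∀ k : ℕ, k * |a k| ≤ A) (hR : ∀ k : ℕ, k * |r k| ≤ R)
    (hA0 : 0 ≤ A) (hR0 : 0 ≤ R) (n : ℕ) :
    n * |∑ k ∈ Finset.range (n + 1), a (n - k) * r k| ≤ A * ∑' k, |r k| + R * ∑' k, |a k| := by
  calc n * |∑ k ∈ Finset.range (n + 1), a (n - k) * r k|
      ≤ n * ∑ k ∈ Finset.range (n + 1), |a (n - k)| * |r k| := by
        gcongr
        exact (Finset.abs_sum_le_sum_abs _ _).trans_eq (by simp [abs_mul])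
    _ ≤ ∑ k ∈ Finset.range (n + 1), (A * |r k| + R * |a (n - k)|) := by
        rw [Finset.mul_sum]
        refine Finset.sum_le_sum fun k hk => ?_
        have hk : k ≤ n := by simpa [Nat.lt_succ_iff] using hk
        have e : (n : ℝ) = (n - k : ℕ) + k := by push_cast [hk]; ring
        have h1 := mul_le_mul_of_nonneg_right (hA (n - k)) (abs_nonneg (r k))
        have h2 := mul_le_mul_of_nonneg_left (hR k) (abs_nonneg (a (n - k)))
        rw [e]
        linarith
    _ = A * ∑ k ∈ Finset.range (n + 1), |r k| + R * ∑ k ∈ Finset.range (n + 1), |a k| := by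
        rw [Finset.sum_add_distrib, ← Finset.mul_sum, ← Finset.mul_sum,
          ← Finset.sum_range_reflect (fun k => |a k|) (n + 1)]
        simp
    _ ≤ _ := by
        gcongr
        · exact hr.sum_le_tsum _ fun _ _ => abs_nonneg _
        · exact ha.sum_le_tsum _ fun _ _ => abs_nonneg _

theorem summable_abs_gbinom {β : ℝ} (hβ1 : 1 < β) (hβ2 : β < 2) :
    Summable fun k => |gbinom β k| := by
  obtain ⟨C, -, hC⟩ := abs_gbinom_le hβ1 hβ2
  refine summable_of_isBigO_nat (g := fun k : ℕ => ((k : ℝ) ^ 2)⁻¹)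
    (Real.summable_nat_pow_inv.2 one_lt_two) (IsBigO.of_bound C ?_)
  filter_upwards [eventually_gt_atTop 0] with k hk
  have hk : (0 : ℝ) < k := by exact_mod_cast hk
  have h := hC k
  rw [Real.norm_eq_abs, abs_abs, Real.norm_eq_abs,
    abs_of_pos (by positivity : (0 : ℝ) < ((k : ℝ) ^ 2)⁻¹), ← div_eq_mul_inv, le_div_iff₀ (by positivity)]
  exact h

theorem tsum_gbinom {β : ℝ} (hβ1 : 1 < β) (hβ2 : β < 2) : ∑' k, gbinom β k = 2 ^ β := by
  have hs := (summable_abs_gbinom hβ1 hβ2).of_abs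
  have h1 := Real.tendsto_tsum_powerSeries_nhdsWithin_lt hs.hasSum.tendsto_sum_nat
  have h2 : Tendsto (fun x : ℝ => (1 + x) ^ β) (𝓝[<] 1) (𝓝 (2 ^ β)) := by
    have : ContinuousAt (fun x : ℝ => (1 + x) ^ β) 1 := by
      apply ContinuousAt.rpow_const (by fun_prop)
      norm_num
    have h := this.tendsto.mono_left (nhdsWithin_le_nhds (s := Set.Iio 1))
    norm_num at h
    exact h
  refine tendsto_nhds_unique (h1.congr' ?_) h2
  filter_upwards [Ioo_mem_nhdsLT (show (0 : ℝ) < 1 by norm_num)] with x hx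
  have h := (Real.one_add_rpow_hasFPowerSeriesOnBall_zero (a := β)).hasSum (y := x)
    (by
    rw [Metric.mem_eball, edist_zero_right, Real.enorm_of_nonneg hx.1.le]
    exact ENNReal.ofReal_lt_one.2 hx.2)
  simp only [binomialSeries_apply, List.ofFn_const, List.prod_replicate, smul_eq_mul,
    ← gbinom_eq_choose, zero_add] at h
  exact h.tsum_eq

theorem abs_sum_gbinom_sub_le {β : ℝ} (hβ1 : 1 < β) (hβ2 : β < 2) :
    ∃ C, ∀ n : ℕ, 1 ≤ n →
      |∑ k ∈ Finset.range (n + 1), gbinom β k - 2 ^ β| ≤ C * (n : ℝ)⁻¹ := by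
  obtain ⟨C, hC0, hC⟩ := abs_gbinom_le hβ1 hβ2
  refine ⟨C, abs_le_of_tendsto_zero_of_abs_sub_le (g := fun n : ℕ => C * (n : ℝ)⁻¹) ?_
    (fun k => by positivity) fun k hk => ?_⟩
  · have h := (summable_abs_gbinom hβ1 hβ2).of_abs.hasSum.tendsto_sum_nat
    rw [tsum_gbinom hβ1 hβ2, ← tendsto_add_atTop_iff_nat 1] at h
    simpa using h.sub_const (2 ^ β)
  · have hk : (0 : ℝ) < k := by exact_mod_cast hk
    have h := hC (k + 1)
    rw [Finset.sum_range_succ _ (k + 1), sub_sub_sub_cancel_right, add_sub_cancel_left]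
    push_cast at h ⊢
    rw [← le_div_iff₀ (by positivity)] at h
    refine h.trans ?_
    rw [← mul_sub, div_eq_mul_inv]
    gcongr
    rw [inv_sub_inv (by positivity) (by positivity), inv_eq_one_div]
    apply div_le_div₀ (by linarith) (by linarith) (by positivity)
    nlinarith

theorem one_add_rpow_sub_isBigO (s : ℝ) :
    (fun x : ℝ => (1 + x) ^ s - (1 + s * x + s * (s - 1) / 2 * x ^ 2
      + s * (s - 1) * (s - 2) / 6 * x ^ 3)) =O[𝓝 0] fun x => x ^ 4 := by
  have h := (Real.one_add_rpow_hasFPowerSeriesAt_zero (a := s)).isBigO_sub_partialSum_pow 4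
  refine (h.congr_left fun x => ?_).trans (IsBigO.of_bound 1 ?_)
  · simp only [FormalMultilinearSeries.partialSum, binomialSeries_apply, List.ofFn_const,
      List.prod_replicate, smul_eq_mul, ← gbinom_eq_choose, zero_add, Finset.sum_range_succ,
      Finset.sum_range_zero, gbinom, Finset.prod_range_succ, Finset.prod_range_zero, Nat.factorial]
    push_cast
    ring
  · simp

theorem tendsto_risingCoeff_mul_rpow {s : ℝ} (hs : 0 < s) :
    Tendsto (fun k : ℕ => risingCoeff s k * Real.Gamma s * (k : ℝ) ^ (1 - s)) atTop (𝓝 1) := by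
  have hΓ := (Real.Gamma_pos_of_pos hs).ne'
  have h1 := (tendsto_const_nhds (x := Real.Gamma s)).div (Real.GammaSeq_tendsto_Gamma s) hΓ
  have h2 := tendsto_natCast_div_add_atTop s
  have h := h1.mul h2
  rw [div_self hΓ, one_mul] at h
  refine h.congr' ?_
  filter_upwards [eventually_gt_atTop 0] with k hk
  have hk : (0 : ℝ) < k := by exact_mod_cast hk
  have hprod : ∏ j ∈ Finset.range k, (s + j) = risingCoeff s k * k.factorial := by
    have : (k.factorial : ℝ) ≠ 0 := by exact_mod_cast k.factorial_ne_zero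
    have e : ∀ j : ℕ, s + j = -1 * (-s - j) := fun j => by ring
    simp only [risingCoeff, gbinom, e, Finset.prod_mul_distrib]
    field_simp
    simp [mul_comm]
  have h3 := risingCoeff_pos hs k
  have h4 : (0 : ℝ) < k.factorial := by exact_mod_cast k.factorial_pos
  have h5 : (0 : ℝ) < (k : ℝ) ^ s := by positivity
  simp only [Pi.div_apply, Real.GammaSeq]
  rw [Finset.prod_range_succ, hprod, Real.rpow_sub hk, Real.rpow_one]
  have : s + k ≠ 0 := by positivity
  have : (k : ℝ) + s ≠ 0 := by positivity
  field_simp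
  ring

/-- The coefficient `q₁` for which
`risingCoeff s k * Γ(s) * k ^ (1 - s) * (1 + q₁ / k + q₂ / k ^ 2) = 1 + O(k ^ (-3))`. -/
noncomputable def corrOne (s : ℝ) : ℝ := -(s * (s - 1) / 2)

/-- The coefficient `q₂` for which
`risingCoeff s k * Γ(s) * k ^ (1 - s) * (1 + q₁ / k + q₂ / k ^ 2) = 1 + O(k ^ (-3))`. -/
noncomputable def corrTwo (s : ℝ) : ℝ :=
  (s * (1 + corrOne s) - corrOne s * ((s + 1) * (s + 2) / 2) - (s + 2) * (s + 1) * s / 6) / 2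

theorem step_isBigO (s : ℝ) :
    (fun x : ℝ => (1 + s * x) * (1 + (2 + corrOne s) * x + (1 + corrOne s + corrTwo s) * x ^ 2)
        * (1 + x) ^ (-(s + 2)) - (1 + corrOne s * x + corrTwo s * x ^ 2))
      =O[𝓝 0] fun x => x ^ 4 := by
  set t := -(s + 2) with ht
  set a₁ := s + (2 + corrOne s) with ha₁
  set a₂ := s * (2 + corrOne s) + (1 + corrOne s + corrTwo s) with ha₂
  set a₃ := s * (1 + corrOne s + corrTwo s) with ha₃
  set t₂ := t * (t - 1) / 2 with ht₂
  set t₃ := t * (t - 1) * (t - 2) / 6 with ht₃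
  have h1 : (fun x : ℝ => (1 + s * x) *
      (1 + (2 + corrOne s) * x + (1 + corrOne s + corrTwo s) * x ^ 2)) =O[𝓝 0]
      fun _ => (1 : ℝ) :=
    (Continuous.tendsto (by fun_prop) 0).isBigO_one ℝ
  have h2 := h1.mul (one_add_rpow_sub_isBigO t)
  have h3 : (fun x : ℝ => (a₁ * t₃ + a₂ * t₂ + a₃ * t) + (a₂ * t₃ + a₃ * t₂) * x
      + a₃ * t₃ * x ^ 2) =O[𝓝 0] fun _ => (1 : ℝ) :=
    (Continuous.tendsto (by fun_prop) 0).isBigO_one ℝ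
  have h4 := h3.mul (isBigO_refl (fun x : ℝ => x ^ 4) (𝓝 0))
  simp only [one_mul] at h2 h4
  refine (h2.add h4).congr_left fun x => ?_
  rw [ha₁, ha₂, ha₃, ht₂, ht₃, ht, corrTwo, corrOne]
  ring

theorem risingCoeff_ratio_isBigO {s : ℝ} (hs : 0 < s) :
    (fun k : ℕ => risingCoeff s k * Real.Gamma s * (k : ℝ) ^ (1 - s)
        * (1 + corrOne s * (k : ℝ)⁻¹ + corrTwo s * (k : ℝ)⁻¹ ^ 2) - 1)
      =O[atTop] fun k : ℕ => ((k : ℝ) ^ 3)⁻¹ := by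
  set T : ℕ → ℝ := fun k => risingCoeff s k * Real.Gamma s * (k : ℝ) ^ (1 - s) with hT
  set ρ : ℕ → ℝ := fun k => T k * (1 + corrOne s * (k : ℝ)⁻¹ + corrTwo s * (k : ℝ)⁻¹ ^ 2) with hρ
  have hT1 : Tendsto T atTop (𝓝 1) := tendsto_risingCoeff_mul_rpow hs
  have hinv : Tendsto (fun k : ℕ => (k : ℝ)⁻¹) atTop (𝓝 0) := tendsto_inv_atTop_nhds_zero_nat
  have hρ1 : Tendsto (fun k => ρ k - 1) atTop (𝓝 0) := by
    have h : Tendsto (fun x : ℝ => 1 + corrOne s * x + corrTwo s * x ^ 2) (𝓝 0) (𝓝 1) := by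
      have : Continuous fun x : ℝ => 1 + corrOne s * x + corrTwo s * x ^ 2 := by fun_prop
      simpa using this.tendsto 0
    have h' := (hT1.mul (h.comp hinv)).sub_const 1
    rw [mul_one, sub_self] at h'
    exact h'
  have hstep := (hT1.isBigO_one ℝ).mul ((step_isBigO s).comp_tendsto hinv)
  obtain ⟨C, hC0, hC⟩ := hstep.exists_pos
  rw [isBigOWith_iff] at hC
  obtain ⟨N, hN⟩ := eventually_atTop.1 (hC.and (eventually_gt_atTop 0))
  refine IsBigO.of_bound (3 * C) ?_
  filter_upwards [eventually_ge_atTop N] with k hk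
  rw [Real.norm_eq_abs, Real.norm_eq_abs, abs_of_nonneg (by positivity : (0 : ℝ) ≤ ((k : ℝ) ^ 3)⁻¹)]
  revert k
  refine abs_le_of_tendsto_zero_of_abs_sub_le (g := fun k : ℕ => 3 * C * ((k : ℝ) ^ 3)⁻¹)
    hρ1 (fun k => by positivity) fun k hk => ?_
  obtain ⟨h1, h2⟩ := hN k hk
  have hk0 : (0 : ℝ) < k := by exact_mod_cast h2
  have hdiff : ρ (k + 1) - 1 - (ρ k - 1) = T k * ((1 + s * (k : ℝ)⁻¹) *
      (1 + (2 + corrOne s) * (k : ℝ)⁻¹ + (1 + corrOne s + corrTwo s) * (k : ℝ)⁻¹ ^ 2)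
        * (1 + (k : ℝ)⁻¹) ^ (-(s + 2)) - (1 + corrOne s * (k : ℝ)⁻¹ + corrTwo s * (k : ℝ)⁻¹ ^ 2)) := by
    have e1 : (1 + (k : ℝ)⁻¹) ^ (-(s + 2))
        = ((k : ℝ) + 1) ^ (1 - s) / (k : ℝ) ^ (1 - s) * ((k : ℝ) / (k + 1)) ^ 3 := by
      rw [← Real.div_rpow (by positivity) hk0.le, show -(s + 2) = (1 - s) - (3 : ℕ) by
        push_cast; ring, Real.rpow_sub_natCast (by positivity)]
      have : 1 + (k : ℝ)⁻¹ = (k + 1) / k := by field_simp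
      rw [this, div_eq_mul_inv _ (((k + 1 : ℝ) / k) ^ 3), ← inv_pow, inv_div]
    have e2 : risingCoeff s (k + 1) = risingCoeff s k * (s + k) / (k + 1) := by
      rw [← risingCoeff_succ]; field_simp
    have h3 : (0 : ℝ) < (k : ℝ) ^ (1 - s) := by positivity
    simp only [hρ, hT]
    rw [e1, e2]
    push_cast
    field_simp
    ring
  rw [hdiff]
  refine h1.trans ?_
  simp only [Function.comp, one_mul, Real.norm_eq_abs]
  rw [abs_of_pos (by positivity), mul_comm 3 C, mul_assoc, mul_assoc, ← mul_sub]
  gcongr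
  push_cast
  rw [← mul_sub, inv_sub_inv (by positivity) (by positivity), inv_pow, inv_eq_one_div,
    mul_div_assoc', div_le_div_iff₀ (by positivity) (by positivity)]
  have hk1 : (1 : ℝ) ≤ k := by exact_mod_cast h2
  have : ((k : ℝ) + 1) ^ 3 ≤ 3 * (((k : ℝ) + 1) ^ 3 - k ^ 3) * k := by
    nlinarith [mul_nonneg hk0.le (sub_nonneg.2 hk1), mul_nonneg (sq_nonneg (k : ℝ)) (sub_nonneg.2 hk1)]
  nlinarith [mul_le_mul_of_nonneg_left this (pow_nonneg hk0.le 3)]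

theorem exists_rpow_expansion {β : ℝ} (hβ : 1 < β) :
    ∃ a b : ℝ, (fun k : ℕ => 1 / Real.Gamma (β + 1) * (k : ℝ) ^ β - (risingCoeff (β + 1) k
        + a * risingCoeff β k + b * risingCoeff (β - 1) k))
      =O[atTop] fun k : ℕ => (k : ℝ) ^ (β - 3) := by
  obtain ⟨s, rfl⟩ : ∃ s, β = s + 1 := ⟨β - 1, by ring⟩
  have hs : 0 < s := by linarith
  have hs1 : 0 < s + 1 := by linarith
  refine ⟨(corrOne s - 2 * s - 1) / (s + 1),
    (corrTwo s - s * (s + 1) - (corrOne s - 2 * s - 1) * s) / (s * (s + 1)), ?_⟩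
  have h := (risingCoeff_ratio_isBigO hs).mul
    (isBigO_refl (fun k : ℕ => (k : ℝ) ^ (s + 1)) atTop)
  refine ((h.const_mul_left (-(1 / Real.Gamma (s + 1 + 1)))).congr' ?_ ?_)
  · filter_upwards [eventually_gt_atTop 0] with k hk
    have hk : (0 : ℝ) < k := by exact_mod_cast hk
    have hΓ := Real.Gamma_pos_of_pos hs
    rw [Real.Gamma_add_one hs1.ne', Real.Gamma_add_one hs.ne', add_sub_cancel_right]
    have e1 : risingCoeff (s + 1) k = risingCoeff s k * (s + k) / s := by
      rw [← risingCoeff_add_one]; field_simp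
    have e2 : risingCoeff (s + 1 + 1) k = risingCoeff s k * (s + k) * (s + 1 + k) / (s * (s + 1)) := by
      have := risingCoeff_add_one (s + 1) k
      rw [e1] at this
      field_simp at this ⊢
      linarith
    have e3 : (k : ℝ) ^ (1 - s) = k ^ 2 / (k : ℝ) ^ (s + 1) := by
      rw [← Real.rpow_natCast, ← Real.rpow_sub hk]; congr 1; push_cast; ring
    have h3 : (0 : ℝ) < (k : ℝ) ^ (s + 1) := by positivity
    rw [e1, e2, e3]
    field_simp
    ring
  · filter_upwards [eventually_gt_atTop 0] with k hk
    have hk : (0 : ℝ) < k := by exact_mod_cast hk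
    rw [← Real.rpow_natCast, ← Real.rpow_neg hk.le, ← Real.rpow_add hk]
    congr 1; push_cast; ring

theorem sum_gbinom_mul_rpow_sub_one_isBigO {β : ℝ} (hβ1 : 1 < β) (hβ2 : β < 2) :
    (fun n : ℕ => 1 / Real.Gamma (β + 1) *
        ∑ k ∈ Finset.range (n + 1), (-1 : ℝ) ^ (n - k) * gbinom β (n - k) * (k : ℝ) ^ β - 1)
      =O[atTop] fun n : ℕ => (n : ℝ)⁻¹ := by
  obtain ⟨a, b, h⟩ := exists_rpow_expansion hβ1
  set r : ℕ → ℝ := fun k => 1 / Real.Gamma (β + 1) * (k : ℝ) ^ β - (risingCoeff (β + 1) k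
        + a * risingCoeff β k + b * risingCoeff (β - 1) k) with hr
  have hrs : Summable fun k => |r k| :=
    (summable_of_isBigO_nat (Real.summable_nat_rpow.2 (by linarith)) h).abs
  obtain ⟨R, hR0, hR⟩ : ∃ R, 0 ≤ R ∧ ∀ k : ℕ, k * |r k| ≤ R := by
    have h1 : (fun k : ℕ => (k : ℝ) ^ (β - 3)) =O[atTop] fun k : ℕ => (k : ℝ)⁻¹ := by
      refine IsBigO.of_bound 1 ?_
      filter_upwards [eventually_ge_atTop 1] with k hk
      have hk : (1 : ℝ) ≤ k := by exact_mod_cast hk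
      rw [one_mul, Real.norm_of_nonneg (by positivity), Real.norm_of_nonneg (by positivity),
        ← Real.rpow_neg_one]
      exact Real.rpow_le_rpow_of_exponent_le hk (by linarith)
    obtain ⟨C, hC0, hC⟩ := bound_of_isBigO_nat_atTop (h.trans h1)
    refine ⟨C, hC0.le, fun k => ?_⟩
    rcases Nat.eq_zero_or_pos k with rfl | hk
    · simpa using hC0.le
    · have hk : (0 : ℝ) < k := by exact_mod_cast hk
      have h2 := hC (x := k) (by positivity)
      rw [Real.norm_eq_abs, Real.norm_of_nonneg (by positivity), ← div_eq_mul_inv,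
        le_div_iff₀ hk] at h2
      linarith
  obtain ⟨A, hA0, hA⟩ := abs_gbinom_le hβ1 hβ2
  have habs : ∀ k, |(-1 : ℝ) ^ k * gbinom β k| = |gbinom β k| := fun k => by
    simp [abs_mul, abs_pow]
  have key := mul_abs_sum_convolution_le (a := fun k => (-1 : ℝ) ^ k * gbinom β k) (r := r)
    (A := A) (R := R) (by simpa only [habs] using summable_abs_gbinom hβ1 hβ2) hrs
    (fun k => by
      rw [habs]
      refine le_trans ?_ (hA k)
      rw [mul_comm]
      gcongr
      exact_mod_cast Nat.le_self_pow two_ne_zero k) hR hA0 hR0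
  refine IsBigO.of_bound
    (A * ∑' k, |r k| + R * ∑' k, |(-1 : ℝ) ^ k * gbinom β k|) ?_
  filter_upwards [eventually_ge_atTop 2] with n hn
  have hn0 : (0 : ℝ) < n := by exact_mod_cast (by omega : 0 < n)
  have e : 1 / Real.Gamma (β + 1) *
      ∑ k ∈ Finset.range (n + 1), (-1 : ℝ) ^ (n - k) * gbinom β (n - k) * (k : ℝ) ^ β - 1
      = ∑ k ∈ Finset.range (n + 1), (-1 : ℝ) ^ (n - k) * gbinom β (n - k) * r k := by
    have h1 := sum_gbinom_mul_risingCoeff β (β + 1) n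
    have h2 := sum_gbinom_mul_risingCoeff β β n
    have h3 := sum_gbinom_mul_risingCoeff β (β - 1) n
    rw [show β - (β + 1) = -1 by ring, gbinom_neg_one, ← mul_pow] at h1
    rw [sub_self, ← Nat.cast_zero, gbinom_natCast_of_lt (by omega), mul_zero] at h2
    have h4 : gbinom 1 n = 0 := by
      exact_mod_cast gbinom_natCast_of_lt (m := 1) (n := n) (by omega)
    rw [sub_sub_cancel, h4, mul_zero] at h3
    norm_num at h1
    simp only [hr, mul_sub, mul_add, Finset.sum_sub_distrib, Finset.sum_add_distrib,
      mul_left_comm _ a, mul_left_comm _ b, ← Finset.mul_sum, h1, h2, h3,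
      mul_left_comm _ (1 / Real.Gamma (β + 1))]
    ring
  rw [e, Real.norm_eq_abs, Real.norm_of_nonneg (by positivity), ← div_eq_mul_inv,
    le_div_iff₀ hn0, mul_comm]
  exact key n

/-- For `1 < β < 2`, `α_k = (−1)^k binom(β,k)`, `θ_k = 2^{−β} binom(β,k)` and
`A_n = (1/Γ(β+1)) ∑_{k=0}^n α_{n−k} k^β − ∑_{k=0}^n θ_{n−k}`, there is `C > 0` such that
`|A_n| ≤ C n^{−1}` for all `n ≥ 1`. -/
theorem stmt_2 (β : ℝ) (hβ1 : 1 < β) (hβ2 : β < 2) :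
    ∃ C > 0, ∀ n : ℕ, 1 ≤ n →
      |(1 / Real.Gamma (β + 1)) *
          ∑ k ∈ Finset.range (n + 1), (-1 : ℝ) ^ (n - k) * gbinom β (n - k) * (k : ℝ) ^ β
        - ∑ k ∈ Finset.range (n + 1), 2 ^ (-β) * gbinom β (n - k)| ≤ C * (n : ℝ)⁻¹ := by
  obtain ⟨C₁, hC₁, h₁⟩ :=
    bound_of_isBigO_nat_atTop (sum_gbinom_mul_rpow_sub_one_isBigO hβ1 hβ2)
  obtain ⟨C₂, h₂⟩ := abs_sum_gbinom_sub_le hβ1 hβ2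
  have hC₂ : 0 ≤ C₂ := by simpa using (abs_nonneg _).trans (h₂ 1 le_rfl)
  refine ⟨C₁ + 2 ^ (-β) * C₂, by positivity, fun n hn => ?_⟩
  have hn0 : (0 : ℝ) < n := by exact_mod_cast hn
  have k₁ := h₁ (x := n) (by positivity)
  have k₂ := mul_le_mul_of_nonneg_left (h₂ n hn) (by positivity : (0 : ℝ) ≤ 2 ^ (-β))
  rw [Real.norm_eq_abs, Real.norm_of_nonneg (by positivity)] at k₁
  have e : ∑ k ∈ Finset.range (n + 1), (2 : ℝ) ^ (-β) * gbinom β (n - k)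
      = 1 + 2 ^ (-β) * (∑ k ∈ Finset.range (n + 1), gbinom β k - 2 ^ β) := by
    rw [mul_sub, ← Real.rpow_add two_pos, neg_add_cancel, Real.rpow_zero, ← Finset.mul_sum,
      ← Finset.sum_range_reflect (fun k => gbinom β k) (n + 1)]
    simp
  rw [e, ← sub_sub]
  refine (abs_sub _ _).trans ?_
  rw [abs_mul, abs_of_pos (by positivity : (0 : ℝ) < 2 ^ (-β))]
  linarith
end

section
/- Let 1 < β < 2 and let s be a real number with s < 0. Then for every complex number z with |z| ≤ 1, one has (1−z)^β − s · 2^{−β} (1+z)^β ≠ 0. (Equivalently: the quantity ((1−z)/(1+z))^β · 2^β, wherever defined on the closed unit disk, never equals a negative real number, and the negative real axis is contained in the stability region S = ℂ \ {α(z)/θ(z) : |z| ≤ 1} with α(z)=(1−z)^β and θ(z)=2^{−β}(1+z)^β.) -/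
/-- For `1 < β < 2` and real `s < 0`, for every complex `z` with `|z| ≤ 1`,
`(1−z)^β − s·2^{−β}(1+z)^β ≠ 0` (complex powers taken with the principal branch, `0^β = 0`).
Equivalently, the negative real axis lies in the stability region
`ℂ \ {(1−z)^β / (2^{−β}(1+z)^β) : |z| ≤ 1}`. -/
theorem stmt_4 (β s : ℝ) (hβ1 : 1 < β) (hβ2 : β < 2) (hs : s < 0) :
    ∀ z : ℂ, ‖z‖ ≤ 1 →
      (1 - z) ^ (β : ℂ) - (s : ℂ) * (2 : ℂ) ^ (-β : ℂ) * (1 + z) ^ (β : ℂ) ≠ 0 := by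
  intro z hz h
  have hβ0 : (β : ℂ) ≠ 0 := by
    exact_mod_cast (by linarith : β ≠ 0)
  have hsc : (s : ℂ) ≠ 0 := by exact_mod_cast hs.ne
  have h2 : (2 : ℂ) ^ (-β : ℂ) = (((2 : ℝ) ^ (-β) : ℝ) : ℂ) := by
    rw [Complex.ofReal_cpow (by norm_num)]
    push_cast
    rfl
  have h2pos : (0 : ℝ) < (2 : ℝ) ^ (-β) := by positivity
  rw [h2] at h
  have h2c : (((2 : ℝ) ^ (-β) : ℝ) : ℂ) ≠ 0 := by exact_mod_cast h2pos.ne'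
  have hsq : z.re ^ 2 + z.im ^ 2 ≤ 1 := by
    have : ‖z‖ ^ 2 ≤ 1 := pow_le_one₀ (norm_nonneg z) hz
    rw [Complex.sq_norm, Complex.normSq_apply] at this
    nlinarith
  by_cases hb : 1 + z = 0
  · have hz' : z = -1 := by linear_combination hb
    subst hz'
    rw [hb, Complex.zero_cpow hβ0, mul_zero, sub_zero, Complex.cpow_eq_zero_iff] at h
    norm_num at h
  by_cases ha : 1 - z = 0
  · rw [ha, Complex.zero_cpow hβ0, zero_sub, neg_eq_zero] at h
    have hb' : (1 + z) ^ (β : ℂ) ≠ 0 := by simp [Complex.cpow_eq_zero_iff, hb]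
    exact mul_ne_zero (mul_ne_zero hsc h2c) hb' h
  have hbre : 0 < (1 + z).re := by
    by_contra! hle
    simp only [Complex.add_re, Complex.one_re] at hle
    apply hb
    apply Complex.ext
    · simp only [Complex.add_re, Complex.one_re, Complex.zero_re]
      nlinarith [sq_nonneg z.im]
    · simp only [Complex.add_im, Complex.one_im, Complex.zero_im]
      have : z.im ^ 2 = 0 := by nlinarith [sq_nonneg z.im]
      simpa using this
  obtain ⟨w, hw⟩ : ∃ w, w = (1 - z) / (1 + z) := ⟨_, rfl⟩
  have hwre : 0 ≤ w.re := by
    rw [hw, Complex.div_re, ← add_div]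
    apply div_nonneg _ (Complex.normSq_nonneg _)
    simp only [Complex.add_re, Complex.sub_re, Complex.one_re, Complex.add_im, Complex.sub_im,
      Complex.one_im]
    nlinarith
  have hw0 : w ≠ 0 := hw ▸ div_ne_zero ha hb
  have hargw := abs_le.1 (Complex.abs_arg_le_pi_div_two_iff.2 hwre)
  have hargb := abs_lt.1 (Complex.abs_arg_lt_pi_div_two_iff.2 (Or.inl hbre))
  have hmul : (1 - z) ^ (β : ℂ) = w ^ (β : ℂ) * (1 + z) ^ (β : ℂ) := by
    have e : 1 - z = w * (1 + z) := by rw [hw, div_mul_cancel₀ _ hb]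
    rw [e, Complex.cpow_def_of_ne_zero (mul_ne_zero hw0 hb), Complex.cpow_def_of_ne_zero hw0,
      Complex.cpow_def_of_ne_zero hb, Complex.log_mul hw0 hb, add_mul, Complex.exp_add]
    constructor <;> linarith [hargw.1, hargw.2, hargb.1, hargb.2]
  have hb' : (1 + z) ^ (β : ℂ) ≠ 0 := by simp [Complex.cpow_eq_zero_iff, hb]
  have hwβ : w ^ (β : ℂ) = ((s * (2 : ℝ) ^ (-β) : ℝ) : ℂ) := by
    apply mul_right_cancel₀ hb'
    rw [← hmul, Complex.ofReal_mul]
    linear_combination h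
  have him : (Complex.log w * (β : ℂ)).im = w.arg * β := by
    simp [Complex.mul_im, Complex.log_im]
  have hpi := Real.pi_pos
  have hlog : Complex.log (w ^ (β : ℂ)) = Complex.log w * β := by
    rw [Complex.cpow_def_of_ne_zero hw0, Complex.log_exp]
    · rw [him]; nlinarith [hargw.1]
    · rw [him]; nlinarith [hargw.2]
  have harg : (w ^ (β : ℂ)).arg = w.arg * β := by
    rw [← Complex.log_im, hlog, him]
  rw [hwβ, Complex.arg_ofReal_of_neg (mul_neg_of_neg_of_pos hs h2pos)] at harg
  nlinarith [hargw.2]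
end

section
/- Let 1 < β < 2 and let S* ≤ 0 be a real number. Let α_k = (−1)^k binom(β,k), θ_k = 2^{−β} binom(β,k), and let (ω_k)_{k≥0} be the real sequence determined by ∑_{j=0}^{k} α_j ω_{k−j} = θ_k for all k ≥ 0 (the Taylor coefficients of ((1+z)/(2(1−z)))^β). Suppose the real sequences (ε^n)_{n≥0} and (η^n)_{n≥0} satisfy ε^n = S* ∑_{k=0}^{n} ω_{n−k} ε^k + η^n for all n ≥ 0, and |η^n| ≤ M for all n. Then there exists a constant C > 0, depending only on β and S* (and not on n or on the sequence η), such that |ε^n| ≤ C M for all n ≥ 0. -/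
open Finset in
/-- **Bessel's inequality** for a bounded power series on the open unit disc. -/
theorem sum_sq_norm_le_of_hasSum_of_norm_le {a : ℕ → ℂ} {K : ℝ}
    (h : ∀ z : ℂ, ‖z‖ < 1 → ∃ w, ‖w‖ ≤ K ∧ HasSum (fun n => a n * z ^ n) w) (m : ℕ) :
    ∑ n ∈ range m, ‖a n‖ ^ 2 ≤ K ^ 2 := by
  have key (r : ℝ) (hr0 : 0 < r) (hr1 : r < 1) :
      ∑ n ∈ range m, (‖a n‖ * r ^ n) ^ 2 ≤ K ^ 2 := by
    have hsum : Summable fun n => ‖a n * (r : ℂ) ^ n‖ := by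
      obtain ⟨w, -, hw⟩ := h r (by simpa [abs_of_pos hr0] using hr1)
      exact hw.summable.norm
    simp only [norm_mul, norm_pow, Complex.norm_real, Real.norm_eq_abs, abs_of_pos hr0] at hsum
    have hlim : Filter.Tendsto (fun N => (K + ∑' n, ‖a (n + N)‖ * r ^ (n + N)) ^ 2)
        Filter.atTop (nhds (K ^ 2)) := by
      simpa using ((tendsto_sum_nat_add fun n => ‖a n‖ * r ^ n).const_add K).pow 2
    refine ge_of_tendsto hlim (Filter.eventually_atTop.2 ⟨m, fun N hN => ?_⟩)
    let p : Polynomial ℂ := ∑ n ∈ range N, Polynomial.monomial n (a n * (r : ℂ) ^ n)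
    have hcoeff (n : ℕ) : p.coeff n = if n < N then a n * (r : ℂ) ^ n else 0 := by
      simp [p, Polynomial.coeff_monomial]
    have hbound (z : ℂ) (hz : ‖z‖ = 1) :
        ‖p.eval z‖ ≤ K + ∑' n, ‖a (n + N)‖ * r ^ (n + N) := by
      have hn : ‖(r : ℂ) * z‖ = r := by simp [hz, abs_of_pos hr0]
      obtain ⟨w, hwK, hw⟩ := h (r * z) (by rwa [hn])
      have hsplit := hw.summable.sum_add_tsum_nat_add N
      rw [hw.tsum_eq] at hsplit
      have hp : p.eval z = ∑ n ∈ range N, a n * (r * z) ^ n := by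
        simp [p, Polynomial.eval_finsetSum, mul_pow, mul_assoc]
      have htail : ‖∑' n, a (n + N) * (r * z) ^ (n + N)‖ ≤ ∑' n, ‖a (n + N)‖ * r ^ (n + N) := by
        refine tsum_of_norm_bounded ((summable_nat_add_iff N).2 hsum).hasSum fun n => ?_
        rw [norm_mul, norm_pow, hn]
      rw [hp, eq_sub_of_add_eq hsplit]
      exact (norm_sub_le _ _).trans (add_le_add hwK htail)
    calc ∑ n ∈ range m, (‖a n‖ * r ^ n) ^ 2
        ≤ ∑ n ∈ range N, (‖a n‖ * r ^ n) ^ 2 :=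
          sum_le_sum_of_subset_of_nonneg (range_subset_range.2 hN) fun _ _ _ => sq_nonneg _
      _ = ∑ n ∈ range N, ‖p.coeff n‖ ^ 2 := by
          refine sum_congr rfl fun n hn => ?_
          rw [hcoeff, if_pos (mem_range.1 hn)]
          simp [abs_of_pos hr0]
      _ = ∑ n ∈ p.support, ‖p.coeff n‖ ^ 2 := by
          refine (sum_subset (fun n hn => ?_) fun n _ hn => ?_).symm
          · rw [Polynomial.mem_support_iff, hcoeff] at hn
            by_contra hc
            exact hn (if_neg (by simpa using hc))
          · simp [Polynomial.notMem_support_iff.1 hn]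
      _ = Real.circleAverage (fun z => ‖p.eval z‖ ^ 2) 0 1 :=
          p.sum_sq_norm_coeff_eq_circleAverage
      _ ≤ (K + ∑' n, ‖a (n + N)‖ * r ^ (n + N)) ^ 2 := by
          refine Real.circleAverage_mono_on_of_le_circle ?_ fun z hz => ?_
          · refine ContinuousOn.circleIntegrable' ?_
            fun_prop
          · exact pow_le_pow_left₀ (norm_nonneg _) (hbound z (by simpa using hz)) 2
  have hlim : Filter.Tendsto (fun r : ℝ => ∑ n ∈ range m, (‖a n‖ * r ^ n) ^ 2)
      (nhdsWithin 1 (Set.Iio 1)) (nhds (∑ n ∈ range m, ‖a n‖ ^ 2)) := by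
    have hc : Continuous fun r : ℝ => ∑ n ∈ range m, (‖a n‖ * r ^ n) ^ 2 := by fun_prop
    simpa using (hc.tendsto 1).mono_left nhdsWithin_le_nhds
  refine le_of_tendsto hlim ?_
  filter_upwards [Ioo_mem_nhdsLT (zero_lt_one' ℝ)] with r hr using key r hr.1 hr.2

open Metric in
/-- A holomorphic function with bounded derivative on the unit disc has summable Taylor
coefficients. -/
theorem summable_norm_taylorCoeff_of_norm_deriv_le {f : ℂ → ℂ} {K : ℝ}
    (hf : DifferentiableOn ℂ f (ball 0 1)) (hK : ∀ z ∈ ball (0 : ℂ) 1, ‖deriv f z‖ ≤ K) :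
    Summable fun n : ℕ => ‖iteratedDeriv n f 0 / n.factorial‖ := by
  let d (n : ℕ) : ℂ := iteratedDeriv n (deriv f) 0 / n.factorial
  have hd : Summable fun n => ‖d n‖ ^ 2 := by
    refine summable_of_sum_range_le (fun _ => sq_nonneg _)
      (sum_sq_norm_le_of_hasSum_of_norm_le (K := K) fun z hz => ⟨deriv f z, ?_, ?_⟩)
    · exact hK z (by simpa using hz)
    · refine (Complex.hasSum_taylorSeries_on_ball (hf.deriv isOpen_ball)
        (z := z) (by simpa using hz)).congr_fun ?_
      intro n
      simp only [d, sub_zero, smul_eq_mul]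
      ring
  have hs : Summable fun n : ℕ => (1 / ((n + 1 : ℕ) : ℝ)) ^ 2 := by
    have := (summable_nat_add_iff 1).2 (Real.summable_one_div_nat_pow.2 one_lt_two)
    simpa using this
  refine (summable_nat_add_iff 1).1 (Summable.of_nonneg_of_le (fun _ => norm_nonneg _)
    (fun n => ?_) (hd.add hs))
  have he : iteratedDeriv (n + 1) f 0 / ((n + 1).factorial : ℂ) = d n / ((n + 1 : ℕ) : ℂ) := by
    rw [iteratedDeriv_succ', Nat.factorial_succ]
    simp only [d, Nat.cast_mul]
    rw [div_div, mul_comm]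
  rw [he, norm_div, Complex.norm_natCast, div_eq_mul_one_div]
  nlinarith [sq_nonneg (‖d n‖ - 1 / ((n + 1 : ℕ) : ℝ)), sq_nonneg (‖d n‖),
    sq_nonneg (1 / ((n + 1 : ℕ) : ℝ))]

/-- The Taylor series of `f` at the origin, as a formal power series. -/
noncomputable def taylorPowerSeries (f : ℂ → ℂ) : PowerSeries ℂ :=
  PowerSeries.mk fun n => iteratedDeriv n f 0 / n.factorial

theorem taylorPowerSeries_mul {f g : ℂ → ℂ} (hf : AnalyticAt ℂ f 0) (hg : AnalyticAt ℂ g 0) :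
    taylorPowerSeries (f * g) = taylorPowerSeries f * taylorPowerSeries g := by
  ext
  simp only [taylorPowerSeries, PowerSeries.coeff_mk,
    iteratedDeriv_mul hf.contDiffAt hg.contDiffAt, Finset.sum_div, PowerSeries.coeff_mul,
    Finset.Nat.sum_antidiagonal_eq_sum_range_succ_mk, Nat.succ_eq_add_one]
  refine Finset.sum_congr rfl fun i hi ↦ ?_
  rw [Nat.cast_choose _ (by grind)]
  field_simp [Nat.factorial_ne_zero]

theorem re_one_add_mul_pos {σ : ℝ} (hσ : |σ| = 1) {z : ℂ} (hz : z ∈ Metric.ball (0 : ℂ) 1) :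
    0 < (1 + σ * z).re := by
  have h1 : ‖(σ : ℂ) * z‖ < 1 := by simpa [hσ] using hz
  have h2 := (Complex.abs_re_le_norm ((σ : ℂ) * z)).trans_lt h1
  rw [Complex.add_re, Complex.one_re]
  linarith [(abs_lt.1 h2).1]

theorem hasDerivAt_one_add_mul_cpow {σ : ℝ} (hσ : |σ| = 1) (γ : ℂ) {z : ℂ}
    (hz : z ∈ Metric.ball (0 : ℂ) 1) :
    HasDerivAt (fun z : ℂ => (1 + σ * z) ^ γ) (σ * γ * (1 + σ * z) ^ (γ - 1)) z := by
  have h := (((hasDerivAt_id z).const_mul (σ : ℂ)).const_add 1).cpow_const (c := γ)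
    (Or.inl (re_one_add_mul_pos hσ hz))
  refine h.congr_deriv ?_
  simp only [id, mul_one]
  ring

theorem iteratedDeriv_one_add_mul_cpow {σ : ℝ} (hσ : |σ| = 1) (γ : ℂ) (n : ℕ) :
    Set.EqOn (iteratedDeriv n fun z : ℂ => (1 + σ * z) ^ γ)
      (fun z => σ ^ n * (∏ i ∈ Finset.range n, (γ - i)) * (1 + σ * z) ^ (γ - n))
      (Metric.ball 0 1) := by
  induction n with
  | zero => intro z _; simp
  | succ n ih =>
    intro z hz
    rw [iteratedDeriv_succ, (ih.eventuallyEq_of_mem (Metric.isOpen_ball.mem_nhds hz)).deriv_eq,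
      ((hasDerivAt_one_add_mul_cpow hσ (γ - n) hz).const_mul _).deriv, Finset.prod_range_succ]
    push_cast
    rw [sub_sub]
    ring

theorem norm_one_add_mul_cpow_le {σ : ℝ} (hσ : |σ| = 1) {γ : ℝ} (hγ : 0 ≤ γ) {z : ℂ}
    (hz : z ∈ Metric.ball (0 : ℂ) 1) : ‖(1 + σ * z) ^ (γ : ℂ)‖ ≤ 2 ^ γ := by
  have h1 : ‖(σ : ℂ) * z‖ < 1 := by simpa [hσ] using hz
  rw [Complex.norm_cpow_real]
  refine Real.rpow_le_rpow (norm_nonneg _) ?_ hγ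
  linarith [norm_add_le (1 : ℂ) (σ * z), norm_one (α := ℂ)]

open Real in
theorem cos_mul_pi_div_two_le_cos_mul {x β : ℝ} (hβ0 : 0 ≤ β) (hβ2 : β ≤ 2) (hx : |x| ≤ π / 2) :
    cos (β * (π / 2)) ≤ cos (x * β) := by
  rw [← cos_abs (x * β), abs_mul, abs_of_nonneg hβ0, mul_comm |x|]
  exact cos_le_cos_of_nonneg_of_le_pi (by positivity) (by nlinarith [pi_pos])
    (mul_le_mul_of_nonneg_left hx hβ0)

open Real in
theorem le_norm_cpow_add_mul_cpow_sq {u v : ℂ} {β c : ℝ} (hβ1 : 1 ≤ β) (hβ2 : β ≤ 2) (hc : 0 ≤ c)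
    (hu : 0 < u.re) (hv : 0 < v.re) (huv : 0 < v.re * u.re + v.im * u.im) :
    (1 + cos (β * (π / 2))) * ((‖u‖ ^ β) ^ 2 + (c * ‖v‖ ^ β) ^ 2) ≤
      ‖u ^ (β : ℂ) + c * v ^ (β : ℂ)‖ ^ 2 := by
  have hau := abs_lt.1 (Complex.abs_arg_lt_pi_div_two_iff.2 (Or.inl hu))
  have hav := abs_lt.1 (Complex.abs_arg_lt_pi_div_two_iff.2 (Or.inl hv))
  have hcos : 0 < cos (v.arg - u.arg) := by
    have h : ‖v‖ * ‖u‖ * cos (v.arg - u.arg) = v.re * u.re + v.im * u.im := by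
      rw [cos_sub]
      linear_combination ‖u‖ * cos u.arg * Complex.norm_mul_cos_arg v +
        v.re * Complex.norm_mul_cos_arg u + ‖u‖ * sin u.arg * Complex.norm_mul_sin_arg v +
        v.im * Complex.norm_mul_sin_arg u
    rw [← h] at huv
    exact pos_of_mul_pos_right huv (by positivity)
  have harg : |v.arg - u.arg| ≤ π / 2 := by
    by_contra! hlt
    have habs : |v.arg - u.arg| ≤ π := abs_le.2 ⟨by linarith, by linarith⟩
    rw [← cos_abs] at hcos
    exact hcos.not_ge (cos_nonpos_of_pi_div_two_le_of_le hlt.le (by linarith [pi_pos]))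
  have hκ := cos_mul_pi_div_two_le_cos_mul (zero_le_one.trans hβ1) hβ2 harg
  have hκ0 : cos (β * (π / 2)) ≤ 0 :=
    cos_nonpos_of_pi_div_two_le_of_le (by nlinarith [pi_pos]) (by nlinarith [pi_pos])
  rw [sub_mul, cos_sub] at hκ
  have hexp : ‖u ^ (β : ℂ) + c * v ^ (β : ℂ)‖ ^ 2 =
      (‖u‖ ^ β) ^ 2 + (c * ‖v‖ ^ β) ^ 2 + 2 * (‖u‖ ^ β * (c * ‖v‖ ^ β)) *
        (cos (v.arg * β) * cos (u.arg * β) + sin (v.arg * β) * sin (u.arg * β)) := by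
    rw [Complex.sq_norm, Complex.normSq_apply]
    simp only [Complex.add_re, Complex.add_im, Complex.re_ofReal_mul, Complex.im_ofReal_mul,
      Complex.cpow_ofReal_re, Complex.cpow_ofReal_im]
    linear_combination (‖u‖ ^ β) ^ 2 * sin_sq_add_cos_sq (u.arg * β) +
      (c * ‖v‖ ^ β) ^ 2 * sin_sq_add_cos_sq (v.arg * β)
  rw [hexp]
  have hab : 0 ≤ ‖u‖ ^ β * (c * ‖v‖ ^ β) := by positivity
  nlinarith [mul_le_mul_of_nonneg_left hκ hab,
    mul_nonneg (neg_nonneg.2 hκ0) (sq_nonneg (‖u‖ ^ β - c * ‖v‖ ^ β))]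

/-- The denominator is bounded away from zero on the open unit disc. -/
theorem exists_pos_le_norm_one_sub_cpow_add {β c : ℝ} (hβ1 : 1 ≤ β) (hβ2 : β < 2) (hc : 0 < c) :
    ∃ δ > 0, ∀ z ∈ Metric.ball (0 : ℂ) 1,
      δ ≤ ‖(1 + (-1 : ℝ) * z) ^ (β : ℂ) + c * (1 + (1 : ℝ) * z) ^ (β : ℂ)‖ := by
  have hκ : 0 < 1 + Real.cos (β * (Real.pi / 2)) := by
    have := Real.cos_lt_cos_of_nonneg_of_le_pi (x := β * (Real.pi / 2)) (y := Real.pi)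
      (by positivity) le_rfl (by nlinarith [Real.pi_pos])
    rw [Real.cos_pi] at this
    linarith
  refine ⟨√((1 + Real.cos (β * (Real.pi / 2))) * min 1 (c ^ 2)), by positivity, fun z hz => ?_⟩
  have hu := re_one_add_mul_pos (σ := -1) (by simp) hz
  have hv := re_one_add_mul_pos (σ := 1) (by simp) hz
  have hz1 : z.re * z.re + z.im * z.im < 1 := by
    rw [← Complex.normSq_apply, ← Complex.sq_norm]
    have := mem_ball_zero_iff.1 hz
    nlinarith [norm_nonneg z]
  refine Real.sqrt_le_iff.2 ⟨norm_nonneg _, ?_⟩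
  refine le_trans (mul_le_mul_of_nonneg_left ?_ hκ.le)
    (le_norm_cpow_add_mul_cpow_sq hβ1 hβ2.le hc.le hu hv ?_)
  · have hone : 1 ≤ ‖1 + ((-1 : ℝ) : ℂ) * z‖ ∨ 1 ≤ ‖1 + ((1 : ℝ) : ℂ) * z‖ := by
      have hu' := Complex.re_le_norm (1 + ((-1 : ℝ) : ℂ) * z)
      have hv' := Complex.re_le_norm (1 + ((1 : ℝ) : ℂ) * z)
      simp only [Complex.add_re, Complex.one_re, Complex.re_ofReal_mul] at hu' hv'
      by_contra! h
      linarith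
    rcases hone with h | h
    · have h1 := one_le_pow₀ (n := 2) (Real.one_le_rpow h (zero_le_one.trans hβ1))
      exact (min_le_left _ _).trans (h1.trans (le_add_of_nonneg_right (sq_nonneg _)))
    · have h1 := one_le_pow₀ (n := 2) (Real.one_le_rpow h (zero_le_one.trans hβ1))
      rw [mul_pow]
      refine (min_le_right _ _).trans ((le_mul_of_one_le_right (sq_nonneg c) h1).trans ?_)
      exact le_add_of_nonneg_left (sq_nonneg _)
  · simp only [Complex.add_re, Complex.one_re, Complex.re_ofReal_mul, Complex.add_im,
      Complex.one_im, Complex.im_ofReal_mul]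
    linarith

/-- A summable sequence `h` with generating function `(1 - z)^β / ((1 - z)^β + c (1 + z)^β)`. -/
theorem exists_summable_mul_eq_mk_gbinom {β c : ℝ} (hβ1 : 1 ≤ β) (hβ2 : β < 2) (hc : 0 < c) :
    ∃ h : ℕ → ℂ, (Summable fun n => ‖h n‖) ∧
      (PowerSeries.mk (fun n => (-1) ^ n * (gbinom β n : ℂ)) +
        (c : ℂ) • PowerSeries.mk fun n => (gbinom β n : ℂ)) * PowerSeries.mk h =
      PowerSeries.mk fun n => (-1) ^ n * (gbinom β n : ℂ) := by
  obtain ⟨δ, hδ, hle⟩ := exists_pos_le_norm_one_sub_cpow_add hβ1 hβ2 hc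
  let U (σ : ℝ) (z : ℂ) : ℂ := (1 + σ * z) ^ (β : ℂ)
  let U' (σ : ℝ) (z : ℂ) : ℂ := σ * β * (1 + σ * z) ^ ((β - 1 : ℝ) : ℂ)
  have hm : |(-1 : ℝ)| = 1 := by simp
  have hp : |(1 : ℝ)| = 1 := by simp
  have hU {σ : ℝ} (hσ : |σ| = 1) {z : ℂ} (hz : z ∈ Metric.ball (0 : ℂ) 1) :
      HasDerivAt (U σ) (U' σ z) z := by
    simpa [U, U'] using hasDerivAt_one_add_mul_cpow hσ (β : ℂ) hz
  have hUb {σ : ℝ} (hσ : |σ| = 1) {z : ℂ} (hz : z ∈ Metric.ball (0 : ℂ) 1) :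
      ‖U σ z‖ ≤ 2 ^ β := norm_one_add_mul_cpow_le hσ (by linarith) hz
  have hUb' {σ : ℝ} (hσ : |σ| = 1) {z : ℂ} (hz : z ∈ Metric.ball (0 : ℂ) 1) :
      ‖U' σ z‖ ≤ β * 2 ^ (β - 1) := by
    have h := norm_one_add_mul_cpow_le hσ (sub_nonneg.2 hβ1) hz
    have hβ : |β| = β := abs_of_nonneg (by linarith)
    simp only [U', norm_mul, Complex.norm_real, Real.norm_eq_abs, hσ, hβ, one_mul]
    exact mul_le_mul_of_nonneg_left h (by linarith)
  let F (z : ℂ) : ℂ := U (-1) z + c * U 1 z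
  have hF0 {z : ℂ} (hz : z ∈ Metric.ball (0 : ℂ) 1) : F z ≠ 0 :=
    norm_pos_iff.1 (hδ.trans_le (hle z hz))
  have hF {z : ℂ} (hz : z ∈ Metric.ball (0 : ℂ) 1) :
      HasDerivAt F (U' (-1) z + c * U' 1 z) z := (hU hm hz).add ((hU hp hz).const_mul _)
  let H (z : ℂ) : ℂ := U (-1) z / F z
  have hH {z : ℂ} (hz : z ∈ Metric.ball (0 : ℂ) 1) :
      HasDerivAt H (c * (U' (-1) z * U 1 z - U (-1) z * U' 1 z) / F z ^ 2) z := by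
    refine ((hU hm hz).div (hF hz) (hF0 hz)).congr_deriv ?_
    congr 1
    simp only [F]
    ring
  have hHb (z : ℂ) (hz : z ∈ Metric.ball (0 : ℂ) 1) :
      ‖deriv H z‖ ≤ c * (β * 2 ^ (β - 1) * 2 ^ β + 2 ^ β * (β * 2 ^ (β - 1))) / δ ^ 2 := by
    have := hUb hm hz
    have := hUb hp hz
    have := hUb' hm hz
    have := hUb' hp hz
    have : δ ≤ ‖F z‖ := hle z hz
    have hnum : ‖U' (-1) z * U 1 z - U (-1) z * U' 1 z‖ ≤
        β * 2 ^ (β - 1) * 2 ^ β + 2 ^ β * (β * 2 ^ (β - 1)) := by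
      refine norm_sub_le_of_le ?_ ?_ <;> exact norm_mul_le_of_le ‹_› ‹_›
    rw [(hH hz).deriv, norm_div, norm_mul, norm_pow, Complex.norm_real, Real.norm_of_nonneg hc.le]
    gcongr
  have hUan {σ : ℝ} (hσ : |σ| = 1) : AnalyticAt ℂ (U σ) 0 :=
    DifferentiableOn.analyticAt (fun z hz => (hU hσ hz).differentiableAt.differentiableWithinAt)
      (Metric.ball_mem_nhds 0 one_pos)
  have hHd : DifferentiableOn ℂ H (Metric.ball 0 1) :=
    fun z hz => (hH hz).differentiableAt.differentiableWithinAt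
  have hHan : AnalyticAt ℂ H 0 := hHd.analyticAt (Metric.ball_mem_nhds 0 one_pos)
  have hFan : AnalyticAt ℂ F 0 := (hUan hm).add (analyticAt_const.mul (hUan hp))
  have hcoeff {σ : ℝ} (hσ : |σ| = 1) (n : ℕ) :
      iteratedDeriv n (U σ) 0 / n.factorial = σ ^ n * (gbinom β n : ℂ) := by
    rw [iteratedDeriv_one_add_mul_cpow hσ β n (Metric.mem_ball_self one_pos)]
    simp [gbinom, mul_div_assoc]
  have hTF : taylorPowerSeries F = PowerSeries.mk (fun n => (-1) ^ n * (gbinom β n : ℂ)) +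
      (c : ℂ) • PowerSeries.mk fun n => (gbinom β n : ℂ) := by
    ext n
    have h1 := hcoeff hm n
    have h2 := hcoeff hp n
    have hadd : iteratedDeriv n F 0 =
        iteratedDeriv n (U (-1)) 0 + c * iteratedDeriv n (U 1) 0 := by
      rw [← iteratedDeriv_const_mul_field]
      exact iteratedDeriv_fun_add (hUan hm).contDiffAt
        (analyticAt_const.mul (hUan hp)).contDiffAt
    simp only [taylorPowerSeries, PowerSeries.coeff_mk, map_add, PowerSeries.coeff_smul, hadd,
      smul_eq_mul, add_div, mul_div_assoc, h1, h2]
    simp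
  have hTU : taylorPowerSeries (F * H) =
      PowerSeries.mk fun n => (-1) ^ n * (gbinom β n : ℂ) := by
    have heq : F * H =ᶠ[nhds 0] U (-1) := by
      filter_upwards [Metric.ball_mem_nhds (0 : ℂ) one_pos] with z hz
      exact mul_div_cancel₀ _ (hF0 hz)
    ext n
    simp only [taylorPowerSeries, PowerSeries.coeff_mk, heq.iteratedDeriv_eq n, hcoeff hm n]
    simp
  refine ⟨_, summable_norm_taylorCoeff_of_norm_deriv_le hHd hHb, ?_⟩
  rw [← hTF, ← hTU, taylorPowerSeries_mul hFan hHan]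
  rfl

/-- With `1 < β < 2`, `S* ≤ 0`, `α_k = (−1)^k binom(β,k)`,
`θ_k = 2^{−β} binom(β,k)` and `ω` determined by `∑_{j=0}^k α_j ω_{k−j} = θ_k`
(the Taylor coefficients of `((1+z)/(2(1−z)))^β`), there is a constant `C > 0`
(depending only on `β` and `S*`) such that whenever
`ε^n = S* ∑_{k=0}^n ω_{n−k} ε^k + η^n` for all `n` with `|η^n| ≤ M`,
one has `|ε^n| ≤ C M` for all `n`. -/
theorem stmt_6 (β Sstar : ℝ) (hβ1 : 1 < β) (hβ2 : β < 2) (hS : Sstar ≤ 0)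
    (ω : ℕ → ℝ)
    (hω : ∀ k : ℕ, ∑ j ∈ Finset.range (k + 1), (-1 : ℝ) ^ j * gbinom β j * ω (k - j) =
      2 ^ (-β) * gbinom β k) :
    ∃ C > 0, ∀ (ε η : ℕ → ℝ) (M : ℝ),
      (∀ n : ℕ, ε n = Sstar * ∑ k ∈ Finset.range (n + 1), ω (n - k) * ε k + η n) →
      (∀ n : ℕ, |η n| ≤ M) →
      ∀ n : ℕ, |ε n| ≤ C * M := by
  rcases hS.eq_or_lt with rfl | hS
  · exact ⟨1, one_pos, fun ε η M hε hη n => by simpa [hε n] using hη n⟩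
  obtain ⟨h, hsum, hh⟩ := exists_summable_mul_eq_mk_gbinom (c := -Sstar * 2 ^ (-β)) hβ1.le hβ2
    (mul_pos (neg_pos.2 hS) (by positivity))
  refine ⟨∑' n, ‖h n‖ + 1, by positivity, fun ε η M hε hη n => ?_⟩
  set A : PowerSeries ℂ := PowerSeries.mk fun n => (-1) ^ n * (gbinom β n : ℂ) with hA
  set B : PowerSeries ℂ := PowerSeries.mk fun n => (gbinom β n : ℂ) with hB
  set c : ℂ := ((-Sstar * 2 ^ (-β) : ℝ) : ℂ) with hc
  let W : PowerSeries ℂ := PowerSeries.mk fun n => (ω n : ℂ)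
  let E : PowerSeries ℂ := PowerSeries.mk fun n => (ε n : ℂ)
  let N : PowerSeries ℂ := PowerSeries.mk fun n => (η n : ℂ)
  have hAW : A * W = ((2 ^ (-β) : ℝ) : ℂ) • B := by
    ext k
    simp only [PowerSeries.coeff_mul, Finset.Nat.sum_antidiagonal_eq_sum_range_succ_mk, hA, hB, W,
      PowerSeries.coeff_mk, PowerSeries.coeff_smul, smul_eq_mul]
    exact_mod_cast hω k
  have hE : E = (Sstar : ℂ) • (E * W) + N := by
    ext k
    simp only [PowerSeries.coeff_mul, Finset.Nat.sum_antidiagonal_eq_sum_range_succ_mk, E, N, W,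
      PowerSeries.coeff_mk, PowerSeries.coeff_smul, smul_eq_mul, map_add]
    have := hε k
    simp only [mul_comm (ω _)] at this
    exact_mod_cast this
  have hF0 : A + c • B ≠ 0 := by
    intro h0
    rw [h0, zero_mul] at hh
    have := congrArg (PowerSeries.coeff 0) hh
    simp [hA, gbinom] at this
  have hFE : (A + c • B) * E = (A + c • B) * (PowerSeries.mk h * N) := by
    rw [← mul_assoc, hh]
    have hcB : c • B = (-Sstar : ℂ) • (A * W) := by
      rw [hAW, smul_smul, hc]
      push_cast
      rfl
    rw [hcB]
    have h2 : A * E = A * ((Sstar : ℂ) • (E * W) + N) := congrArg (A * ·) hE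
    simp only [PowerSeries.smul_eq_C_mul, map_neg] at h2 ⊢
    linear_combination h2
  have hEh := mul_left_cancel₀ hF0 hFE
  have hn : (ε n : ℂ) = ∑ k ∈ Finset.range (n + 1), h k * (η (n - k) : ℂ) := by
    have := congrArg (PowerSeries.coeff n) hEh
    simpa only [PowerSeries.coeff_mul, Finset.Nat.sum_antidiagonal_eq_sum_range_succ_mk, E, N,
      PowerSeries.coeff_mk] using this
  have hM : 0 ≤ M := (abs_nonneg _).trans (hη 0)
  calc |ε n| = ‖(ε n : ℂ)‖ := by simp
    _ ≤ ∑ k ∈ Finset.range (n + 1), ‖h k‖ * M := by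
        rw [hn]
        refine norm_sum_le_of_le _ fun k _ => ?_
        rw [norm_mul, Complex.norm_real]
        exact mul_le_mul_of_nonneg_left (hη _) (norm_nonneg _)
    _ ≤ (∑' n, ‖h n‖) * M := by
        rw [← Finset.sum_mul]
        exact mul_le_mul_of_nonneg_right
          (hsum.sum_le_tsum _ fun _ _ => norm_nonneg _) hM
    _ ≤ (∑' n, ‖h n‖ + 1) * M := by nlinarith
end

section
/- Let 1 < β < 2 and t > 0, and let g : [0,t] → ℝ be three times continuously differentiable with g(0) = 0 and g'(0) = 0. Let α_k = (−1)^k binom(β,k). Then lim_{n→∞} (n/t)^{β} ∑_{k=0}^{n} α_{n−k} g(k t/n) = (1/Γ(2−β)) ∫_0^t (t−s)^{1−β} g''(s) ds; that is, the Grünwald–Letnikov approximation with step τ = t/n converges to the Caputo (equivalently, under these hypotheses, Riemann–Liouville) fractional derivative of order β of g at t. -/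
open Filter Topology MeasureTheory Finset

/-- The coefficients `γ(γ+1)⋯(γ+m−1)/m!` of the power series of `(1-z)^(-γ)`. -/
noncomputable def negBinomCoeff (γ : ℝ) (m : ℕ) : ℝ :=
  (∏ i ∈ range m, (γ + i)) / (Nat.factorial m)

lemma negBinomCoeff_zero (γ : ℝ) : negBinomCoeff γ 0 = 1 := by simp [negBinomCoeff]

lemma negBinomCoeff_succ (γ : ℝ) (m : ℕ) :
    negBinomCoeff γ (m + 1) = negBinomCoeff γ m * ((γ + m) / (m + 1)) := by
  have : (Nat.factorial m : ℝ) ≠ 0 := by positivity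
  simp only [negBinomCoeff, prod_range_succ, Nat.factorial_succ]
  push_cast
  field_simp

lemma negBinomCoeff_pos {γ : ℝ} (hγ : 0 < γ) (m : ℕ) : 0 < negBinomCoeff γ m := by
  have : ∀ i ∈ range m, 0 < γ + (i : ℝ) := fun i _ => by positivity
  have := prod_pos this
  unfold negBinomCoeff
  positivity

lemma neg_one_pow_mul_gbinom (β : ℝ) (m : ℕ) :
    (-1) ^ m * gbinom β m = negBinomCoeff (-β) m := by
  have : ∏ i ∈ range m, (-β + i) = (-1) ^ m * ∏ i ∈ range m, (β - i) := by
    rw [← card_range m, ← prod_const, card_range, ← prod_mul_distrib]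
    exact prod_congr rfl fun i _ => by ring
  rw [gbinom, negBinomCoeff, this, mul_div_assoc]

lemma negBinomCoeff_sub_one_succ (γ : ℝ) (m : ℕ) :
    negBinomCoeff (γ - 1) (m + 1) = negBinomCoeff γ (m + 1) - negBinomCoeff γ m := by
  induction m with
  | zero => simp [negBinomCoeff]
  | succ m ih =>
    rw [negBinomCoeff_succ, ih, negBinomCoeff_succ γ (m + 1), negBinomCoeff_succ γ m]
    push_cast
    field_simp
    ring

lemma sum_negBinomCoeff_sub_one_mul (γ : ℝ) (u : ℕ → ℝ) (hu : u 0 = 0) (n : ℕ) :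
    ∑ k ∈ range (n + 1), negBinomCoeff (γ - 1) (n - k) * u k =
      ∑ k ∈ range (n + 1), negBinomCoeff γ (n - k) * (u k - u (k - 1)) := by
  have h1 : ∑ k ∈ range (n + 1), negBinomCoeff γ (n - k) * u (k - 1) =
      ∑ k ∈ range n, negBinomCoeff γ (n - 1 - k) * u k := by
    rw [sum_range_succ']
    simp only [zero_tsub, hu, mul_zero, add_zero, Nat.add_sub_cancel]
    exact sum_congr rfl fun k _ => by rw [Nat.sub_sub, add_comm 1 k]
  simp only [mul_sub]
  rw [sum_sub_distrib, h1, sum_range_succ, sum_range_succ, add_sub_right_comm,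
    ← sum_sub_distrib, Nat.sub_self, negBinomCoeff_zero, negBinomCoeff_zero]
  congr 1
  refine sum_congr rfl fun k hk => ?_
  obtain ⟨j, rfl⟩ := Nat.exists_eq_add_of_lt (mem_range.1 hk)
  rw [show k + j + 1 - k = j + 1 by lia, show k + j + 1 - 1 - k = j by lia,
    negBinomCoeff_sub_one_succ]
  ring

lemma negBinomCoeff_mul_rpow_le {γ : ℝ} (h0 : 0 < γ) (h1 : γ < 1) (m : ℕ) :
    negBinomCoeff γ m * ((m : ℝ) + 1) ^ (1 - γ) ≤ 1 := by
  induction m with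
  | zero => simp [negBinomCoeff]
  | succ m ih =>
    have hc := negBinomCoeff_pos h0 m
    have hm : (0 : ℝ) < m + 1 := by positivity
    rw [negBinomCoeff_succ]
    push_cast
    have key : (1 + 1 / ((m : ℝ) + 1)) ^ (1 - γ) ≤ 1 + (1 - γ) * (1 / ((m : ℝ) + 1)) :=
      rpow_one_add_le_one_add_mul_self
        (le_trans (by norm_num) (by positivity : 0 ≤ 1 / ((m : ℝ) + 1)))
        (by linarith) (by linarith)
    have hsplit : ((m : ℝ) + 1 + 1) ^ (1 - γ) =
        (m + 1 : ℝ) ^ (1 - γ) * (1 + 1 / ((m : ℝ) + 1)) ^ (1 - γ) := by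
      rw [← Real.mul_rpow hm.le (by positivity)]
      congr 1
      field_simp
    have hle : (γ + m) / (m + 1) * (1 + 1 / ((m : ℝ) + 1)) ^ (1 - γ) ≤ 1 := by
      refine (mul_le_mul_of_nonneg_left key (by positivity)).trans ?_
      rw [show (γ + m) / (m + 1) * (1 + (1 - γ) * (1 / ((m : ℝ) + 1))) =
        1 - ((1 - γ) / (m + 1)) ^ 2 by field_simp; ring]
      nlinarith [sq_nonneg ((1 - γ) / ((m : ℝ) + 1))]
    rw [hsplit]
    calc _ = (negBinomCoeff γ m * (m + 1 : ℝ) ^ (1 - γ)) *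
          ((γ + m) / (m + 1) * (1 + 1 / ((m : ℝ) + 1)) ^ (1 - γ)) := by ring
      _ ≤ 1 := mul_le_one₀ ih (by positivity) hle

lemma tendsto_rpow_mul_negBinomCoeff {γ : ℝ} (h0 : 0 < γ) :
    Tendsto (fun m : ℕ => (m : ℝ) ^ (1 - γ) * negBinomCoeff γ m) atTop
      (𝓝 (1 / Real.Gamma γ)) := by
  have hG := Real.GammaSeq_tendsto_Gamma γ
  have hq : Tendsto (fun m : ℕ => (m : ℝ) / (m + γ)) atTop (𝓝 1) :=
    tendsto_natCast_div_add_atTop γ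
  refine (hq.div hG (Real.Gamma_pos_of_pos h0).ne').congr' ?_
  filter_upwards [eventually_gt_atTop 0] with m hm
  have hm' : (0 : ℝ) < m := by exact_mod_cast hm
  have hp : 0 < ∏ i ∈ range m, (γ + (i : ℝ)) := prod_pos fun i _ => by positivity
  have hf : (0 : ℝ) < Nat.factorial m := by positivity
  have hr : (m : ℝ) ^ (1 - γ) = m / (m : ℝ) ^ γ := by
    rw [Real.rpow_sub hm', Real.rpow_one]
  have : 0 < (m : ℝ) ^ γ := by positivity
  simp only [Pi.div_apply, Real.GammaSeq, negBinomCoeff, prod_range_succ, hr]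
  field_simp
  ring

lemma exists_second_difference_eq {g : ℝ → ℝ} (hg : ContDiff ℝ 2 g) (x : ℝ) {h : ℝ} (hh : 0 < h) :
    ∃ d ∈ Set.Icc (x - 2 * h) x,
      g x - g (x - h) - g (x - h) + g (x - 2 * h) = h ^ 2 * iteratedDeriv 2 g d := by
  have hd : Differentiable ℝ g := hg.differentiable (by norm_num)
  have hd' : Differentiable ℝ (deriv g) := hg.differentiable_deriv_two
  have hφ : ∀ y, HasDerivAt (fun y => g y - g (y - h)) (deriv g y - deriv g (y - h)) y := fun y =>
    (hd y).hasDerivAt.sub ((hd (y - h)).hasDerivAt.comp_sub_const y h)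
  obtain ⟨c, hc, hc'⟩ := exists_hasDerivAt_eq_slope (fun y => g y - g (y - h))
    (fun y => deriv g y - deriv g (y - h)) (show x - h < x by linarith)
    (fun y _ => (hφ y).continuousAt.continuousWithinAt) (fun y _ => hφ y)
  obtain ⟨d, hd1, hd2⟩ := exists_hasDerivAt_eq_slope (deriv g) (deriv (deriv g))
    (show c - h < c by linarith) hd'.continuous.continuousOn (fun y _ => (hd' y).hasDerivAt)
  refine ⟨d, ⟨by linarith [hc.1, hd1.1], by linarith [hc.2, hd1.2]⟩, ?_⟩
  rw [iteratedDeriv_succ, iteratedDeriv_one, hd2]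
  rw [sub_sub_cancel, eq_div_iff hh.ne', show x - h - h = x - 2 * h by ring] at hc'
  rw [sub_sub_cancel, sq, mul_assoc, mul_div_cancel₀ _ hh.ne']
  linarith

lemma abs_le_sq_mul_of_iteratedDeriv_two_le {g : ℝ → ℝ} (hg : ContDiff ℝ 2 g) (hg0 : g 0 = 0)
    (hg0' : deriv g 0 = 0) {h M : ℝ} (hh : 0 < h)
    (hM : ∀ d ∈ Set.Icc 0 h, |iteratedDeriv 2 g d| ≤ M) : |g h| ≤ h ^ 2 * M := by
  have hd : Differentiable ℝ g := hg.differentiable (by norm_num)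
  have hd' : Differentiable ℝ (deriv g) := hg.differentiable_deriv_two
  obtain ⟨c, hc, hc'⟩ := exists_deriv_eq_slope g hh hd.continuous.continuousOn hd.differentiableOn
  obtain ⟨d, hd1, hd2⟩ := exists_deriv_eq_slope (deriv g) hc.1 hd'.continuous.continuousOn
    hd'.differentiableOn
  have hdM := hM d ⟨hd1.1.le, (hd1.2.trans hc.2).le⟩
  rw [iteratedDeriv_succ, iteratedDeriv_one] at hdM
  have hc0 := hc.1
  rw [hg0, sub_zero, sub_zero, eq_div_iff hh.ne'] at hc'
  rw [hg0', sub_zero, sub_zero, eq_div_iff hc0.ne'] at hd2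
  have : g h = h * c * deriv (deriv g) d := by
    rw [← hc', ← hd2]
    ring
  rw [this, abs_mul, abs_of_pos (by positivity), sq]
  gcongr
  exact hc.2.le

lemma integral_floor_mul {n : ℕ} (hn : 0 < n) (w : ℕ → ℝ) :
    ∫ x in (0 : ℝ)..1, w ⌊x * n⌋₊ = (n : ℝ)⁻¹ * ∑ m ∈ range n, w m := by
  have hn' : (0 : ℝ) < n := by exact_mod_cast hn
  have hae : ∀ m : ℕ, (fun _ => w m) =ᵐ[volume.restrict (Set.uIoc ((m : ℝ) / n) ((m + 1 : ℕ) / n))]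
      fun x : ℝ => w ⌊x * n⌋₊ := by
    intro m
    have hlt : (m : ℝ) / n ≤ (m + 1 : ℕ) / n := by gcongr; lia
    rw [Set.uIoc_of_le hlt, ← Measure.restrict_congr_set Ioo_ae_eq_Ioc]
    filter_upwards [self_mem_ae_restrict measurableSet_Ioo] with x hx
    have h1 := (div_lt_iff₀ hn').1 hx.1
    have h2 := (lt_div_iff₀ hn').1 hx.2
    push_cast at h2
    rw [(Nat.floor_eq_iff (le_trans (by positivity) h1.le)).2 ⟨h1.le, h2⟩]
  have hint : ∀ m < n, IntervalIntegrable (fun x : ℝ => w ⌊x * n⌋₊) volume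
      ((m : ℝ) / n) ((m + 1 : ℕ) / n) := fun m _ =>
    (intervalIntegrable_const (c := w m)).congr_ae (hae m)
  have := intervalIntegral.sum_integral_adjacent_intervals (a := fun m : ℕ => (m : ℝ) / n) hint
  simp only [Nat.cast_zero, zero_div, div_self hn'.ne'] at this
  rw [← this, mul_sum]
  refine sum_congr rfl fun m _ => ?_
  rw [← intervalIntegral.integral_congr_ae_restrict (hae m), intervalIntegral.integral_const,
    smul_eq_mul]
  push_cast
  field_simp
  ring

/-- The backward second difference at index `n - m` of the samples `g (k t / n)`, divided by the
square of the step `t / n`. -/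
noncomputable def secondQuotient (g : ℝ → ℝ) (t : ℝ) (n m : ℕ) : ℝ :=
  ((n : ℝ) / t) ^ 2 * (g ((n - m : ℕ) * t / n) - g ((n - m - 1 : ℕ) * t / n) -
    (g ((n - m - 1 : ℕ) * t / n) - g ((n - m - 1 - 1 : ℕ) * t / n)))

lemma exists_secondQuotient_eq {g : ℝ → ℝ} (hg : ContDiff ℝ 2 g) {t : ℝ} (ht : 0 < t) {n m : ℕ}
    (h : m + 2 ≤ n) :
    ∃ d ∈ Set.Icc (t - ((m : ℝ) / n + 2 / n) * t) (t - (m : ℝ) / n * t),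
      secondQuotient g t n m = iteratedDeriv 2 g d := by
  have hn : (0 : ℝ) < n := by exact_mod_cast (show 0 < n by lia)
  obtain ⟨d, hd, h2⟩ := exists_second_difference_eq hg (t - (m : ℝ) / n * t) (div_pos ht hn)
  refine ⟨d, ⟨le_trans (le_of_eq (by ring)) hd.1, hd.2⟩, ?_⟩
  have e0 : ((n - m : ℕ) : ℝ) * t / n = t - (m : ℝ) / n * t := by
    rw [Nat.cast_sub (by lia)]
    field_simp
  have e1 : ((n - m - 1 : ℕ) : ℝ) * t / n = t - (m : ℝ) / n * t - t / n := by
    rw [Nat.sub_sub, Nat.cast_sub (by lia)]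
    push_cast
    field_simp
    ring
  have e2 : ((n - m - 1 - 1 : ℕ) : ℝ) * t / n = t - (m : ℝ) / n * t - 2 * (t / n) := by
    rw [Nat.sub_sub, Nat.sub_sub, Nat.cast_sub (by lia)]
    push_cast
    field_simp
    ring
  rw [secondQuotient, e0, e1, e2, ← sub_add, h2]
  field_simp

lemma abs_secondQuotient_le {g : ℝ → ℝ} (hg : ContDiff ℝ 2 g) (hg0 : g 0 = 0)
    (hg0' : deriv g 0 = 0) {t M : ℝ} (ht : 0 < t)
    (hM : ∀ d ∈ Set.Icc 0 t, |iteratedDeriv 2 g d| ≤ M) {n m : ℕ} (h : m < n) :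
    |secondQuotient g t n m| ≤ M := by
  have hn : (0 : ℝ) < n := by exact_mod_cast (show 0 < n by lia)
  rcases Nat.lt_or_ge (m + 1) n with h2 | h2
  · obtain ⟨d, hd, e⟩ := exists_secondQuotient_eq hg ht h2
    rw [e]
    refine hM d ⟨le_trans ?_ hd.1, hd.2.trans ?_⟩
    · have : (m : ℝ) / n + 2 / n ≤ 1 := by
        rw [← add_div, div_le_one hn]
        exact_mod_cast h2
      nlinarith
    · have : 0 ≤ (m : ℝ) / n * t := by positivity
      linarith
  · have hle : t / n ≤ t := div_le_self ht.le (by exact_mod_cast (show 1 ≤ n by lia))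
    have := abs_le_sq_mul_of_iteratedDeriv_two_le hg hg0 hg0' (div_pos ht hn)
      fun d hd => hM d ⟨hd.1, hd.2.trans hle⟩
    rw [secondQuotient, show n - m = 1 by lia]
    simp only [Nat.cast_one, one_mul, Nat.sub_self, Nat.cast_zero, zero_mul, zero_div, hg0, sub_zero,
      zero_tsub]
    rw [abs_mul, abs_of_nonneg (by positivity)]
    calc _ ≤ ((n : ℝ) / t) ^ 2 * ((t / n) ^ 2 * M) := by gcongr
      _ = M := by field_simp

lemma rpow_mul_sum_eq_sum_secondQuotient {β t : ℝ} (ht : 0 < t) {g : ℝ → ℝ} (hg0 : g 0 = 0) {n : ℕ}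
    (hn : 0 < n) :
    ((n : ℝ) / t) ^ β * ∑ k ∈ range (n + 1), (-1 : ℝ) ^ (n - k) * gbinom β (n - k) *
        g ((k : ℝ) * t / n) =
      (n : ℝ)⁻¹ * ∑ m ∈ range n, t ^ (2 - β) * ((n : ℝ) ^ (1 - (2 - β)) *
        negBinomCoeff (2 - β) m) * secondQuotient g t n m := by
  have hn' : (0 : ℝ) < n := by exact_mod_cast hn
  have hscale : ((n : ℝ) / t) ^ β =
      (n : ℝ)⁻¹ * t ^ (2 - β) * (n : ℝ) ^ (1 - (2 - β)) * ((n : ℝ) / t) ^ 2 := by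
    rw [Real.div_rpow hn'.le ht.le, Real.rpow_sub ht, show 1 - (2 - β) = β - 1 by ring,
      Real.rpow_sub hn', Real.rpow_one, Real.rpow_two]
    have := Real.rpow_pos_of_pos ht β
    field_simp
  simp only [neg_one_pow_mul_gbinom]
  rw [show -β = 2 - β - 1 - 1 by ring,
    sum_negBinomCoeff_sub_one_mul _ (fun k : ℕ => g (k * t / n)) (by simp [hg0]),
    sum_negBinomCoeff_sub_one_mul _
      (fun k : ℕ => g (k * t / n) - g ((k - 1 : ℕ) * t / n)) (by simp),
    ← sum_range_reflect, sum_range_succ, mul_sum, hscale, mul_add, mul_sum]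
  simp only [add_tsub_cancel_right, Nat.sub_self, zero_tsub, sub_self, mul_zero, add_zero]
  refine sum_congr rfl fun m hm => ?_
  rw [Nat.sub_sub_self (mem_range.1 hm).le, secondQuotient]
  ring

lemma tendsto_rpow_mul_negBinomCoeff_floor {γ : ℝ} (h0 : 0 < γ) {x : ℝ} (hx : 0 < x) :
    Tendsto (fun n : ℕ => (n : ℝ) ^ (1 - γ) * negBinomCoeff γ ⌊x * n⌋₊) atTop
      (𝓝 (x ^ (γ - 1) * (1 / Real.Gamma γ))) := by
  have hfl : Tendsto (fun n : ℕ => ⌊x * n⌋₊) atTop atTop := tendsto_nat_floor_mul_atTop x hx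
  have hdiv : Tendsto (fun n : ℕ => (⌊x * n⌋₊ : ℝ) / n) atTop (𝓝 x) :=
    (tendsto_nat_floor_mul_div_atTop hx.le).comp tendsto_natCast_atTop_atTop
  refine ((hdiv.rpow_const (p := γ - 1) (Or.inl hx.ne')).mul
    ((tendsto_rpow_mul_negBinomCoeff h0).comp hfl)).congr' ?_
  filter_upwards [hfl.eventually_gt_atTop 0, eventually_gt_atTop 0] with n hm hn
  have hm' : (0 : ℝ) < ⌊x * n⌋₊ := by exact_mod_cast hm
  have hn' : (0 : ℝ) < n := by exact_mod_cast hn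
  rw [Function.comp_apply, ← mul_assoc, Real.div_rpow hm'.le hn'.le, div_mul_eq_mul_div,
    ← Real.rpow_add hm', show γ - 1 + (1 - γ) = 0 by ring, Real.rpow_zero, one_div,
    ← Real.rpow_neg hn'.le, neg_sub]

lemma tendsto_secondQuotient_floor {g : ℝ → ℝ} (hg : ContDiff ℝ 2 g) {t x : ℝ} (ht : 0 < t)
    (hx : x ∈ Set.Ioo 0 1) :
    Tendsto (fun n : ℕ => secondQuotient g t n ⌊x * n⌋₊) atTop
      (𝓝 (iteratedDeriv 2 g (t - t * x))) := by
  have hcont : Continuous (iteratedDeriv 2 g) := hg.continuous_iteratedDeriv 2 le_rfl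
  have hdiv : Tendsto (fun n : ℕ => (⌊x * n⌋₊ : ℝ) / n) atTop (𝓝 x) :=
    (tendsto_nat_floor_mul_div_atTop hx.1.le).comp tendsto_natCast_atTop_atTop
  have h2 : Tendsto (fun n : ℕ => (2 : ℝ) / n) atTop (𝓝 0) := tendsto_const_div_atTop_nhds_zero_nat 2
  have hlt : ∀ᶠ n : ℕ in atTop, ⌊x * n⌋₊ + 2 ≤ n := by
    have h3 : Tendsto (fun n : ℕ => (⌊x * n⌋₊ : ℝ) / n + 2 / n) atTop (𝓝 x) := by
      simpa using hdiv.add h2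
    filter_upwards [h3.eventually_lt_const hx.2, eventually_gt_atTop 0] with n h hn
    have hn' : (0 : ℝ) < n := by exact_mod_cast hn
    rw [← add_div, div_lt_one hn'] at h
    exact_mod_cast h.le
  have hd : ∀ n : ℕ, ∃ d, ⌊x * n⌋₊ + 2 ≤ n →
      d ∈ Set.Icc (t - ((⌊x * n⌋₊ : ℝ) / n + 2 / n) * t) (t - (⌊x * n⌋₊ : ℝ) / n * t) ∧
      secondQuotient g t n ⌊x * n⌋₊ = iteratedDeriv 2 g d := fun n => by
    by_cases h : ⌊x * n⌋₊ + 2 ≤ n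
    · obtain ⟨d, h1, h2⟩ := exists_secondQuotient_eq hg ht h
      exact ⟨d, fun _ => ⟨h1, h2⟩⟩
    · exact ⟨0, fun h' => absurd h' h⟩
  choose d hd using hd
  have hdlim : Tendsto d atTop (𝓝 (t - t * x)) := by
    refine tendsto_of_tendsto_of_tendsto_of_le_of_le' (g := fun n : ℕ =>
      t - ((⌊x * n⌋₊ : ℝ) / n + 2 / n) * t) (h := fun n : ℕ => t - (⌊x * n⌋₊ : ℝ) / n * t) ?_ ?_
      (hlt.mono fun n h => (hd n h).1.1) (hlt.mono fun n h => (hd n h).1.2)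
    · simpa [mul_comm] using ((hdiv.add h2).mul_const t).const_sub t
    · simpa [mul_comm] using (hdiv.mul_const t).const_sub t
  exact ((hcont.tendsto _).comp hdlim).congr' (hlt.mono fun n h => (hd n h).2.symm)

lemma integral_rpow_mul_comp_sub {γ t : ℝ} (ht : 0 < t) (f : ℝ → ℝ) :
    ∫ x in (0 : ℝ)..1, t ^ γ * (x ^ (γ - 1) * (1 / Real.Gamma γ)) * f (t - t * x) =
      (1 / Real.Gamma γ) * ∫ s in (0 : ℝ)..t, (t - s) ^ (γ - 1) * f s := by
  have hsub := intervalIntegral.integral_comp_sub_mul (a := 0) (b := 1)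
    (fun s => (t - s) ^ (γ - 1) * f s) ht.ne' t
  simp only [mul_one, mul_zero, sub_self, sub_zero, smul_eq_mul] at hsub
  rw [inv_mul_eq_div, eq_div_iff ht.ne'] at hsub
  rw [← hsub, ← intervalIntegral.integral_mul_const, ← intervalIntegral.integral_const_mul]
  refine intervalIntegral.integral_congr fun x hx => ?_
  rw [Set.uIcc_of_le zero_le_one] at hx
  simp only [sub_sub_cancel]
  rw [Real.mul_rpow ht.le hx.1, Real.rpow_sub ht, Real.rpow_one]
  field_simp

/-- For `1 < β < 2`, `t > 0` and `g` three times continuously differentiable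
with `g(0) = g'(0) = 0`, the Grünwald–Letnikov approximation with step `τ = t/n`
converges to the Caputo fractional derivative of order `β` of `g` at `t`:
`lim_{n→∞} (n/t)^β ∑_{k=0}^n (−1)^{n−k} binom(β,n−k) g(kt/n)
  = (1/Γ(2−β)) ∫_0^t (t−s)^{1−β} g''(s) ds`. -/
theorem stmt_8 (β t : ℝ) (hβ1 : 1 < β) (hβ2 : β < 2) (ht : 0 < t)
    (g : ℝ → ℝ) (hg : ContDiff ℝ 3 g) (hg0 : g 0 = 0) (hg0' : deriv g 0 = 0) :
    Filter.Tendsto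
      (fun n : ℕ => ((n : ℝ) / t) ^ β *
        ∑ k ∈ Finset.range (n + 1), (-1 : ℝ) ^ (n - k) * gbinom β (n - k) * g ((k : ℝ) * t / n))
      Filter.atTop
      (nhds ((1 / Real.Gamma (2 - β)) *
        ∫ s in (0 : ℝ)..t, (t - s) ^ (1 - β) * iteratedDeriv 2 g s)) := by
  have hg2 : ContDiff ℝ 2 g := hg.of_le (by norm_num)
  have hcont : Continuous (iteratedDeriv 2 g) := hg2.continuous_iteratedDeriv 2 le_rfl
  have hγ0 : 0 < 2 - β := by linarith
  have hγ1 : 2 - β < 1 := by linarith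
  obtain ⟨M, hM⟩ := isCompact_Icc.exists_bound_of_continuousOn (s := Set.Icc 0 t) hcont.continuousOn
  have hlim : 1 - β = 2 - β - 1 := by ring
  rw [hlim, ← integral_rpow_mul_comp_sub ht]
  have hdom : Tendsto (fun n : ℕ => ∫ x in (0 : ℝ)..1, t ^ (2 - β) * ((n : ℝ) ^ (1 - (2 - β)) *
      negBinomCoeff (2 - β) ⌊x * n⌋₊) * secondQuotient g t n ⌊x * n⌋₊) atTop
      (𝓝 (∫ x in (0 : ℝ)..1, t ^ (2 - β) * (x ^ (2 - β - 1) * (1 / Real.Gamma (2 - β))) *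
        iteratedDeriv 2 g (t - t * x))) := by
    refine intervalIntegral.tendsto_integral_filter_of_dominated_convergence
      (fun x => t ^ (2 - β) * x ^ (2 - β - 1) * M) (Eventually.of_forall fun n => ?_) ?_ ?_ ?_
    · have : Measurable fun x : ℝ => ⌊x * n⌋₊ := Nat.measurable_floor.comp (measurable_mul_const _)
      exact ((measurable_from_nat (f := fun m => t ^ (2 - β) * ((n : ℝ) ^ (1 - (2 - β)) *
        negBinomCoeff (2 - β) m) * secondQuotient g t n m)).comp this).aestronglyMeasurable
    · filter_upwards [eventually_gt_atTop 0] with n hn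
      have hn' : (0 : ℝ) < n := by exact_mod_cast hn
      filter_upwards [Measure.ae_ne volume (1 : ℝ)] with x hx1 hx
      rw [Set.uIoc_of_le zero_le_one] at hx
      have hxn : 0 < x * n := mul_pos hx.1 hn'
      have hfl : ⌊x * n⌋₊ < n := by
        rw [Nat.floor_lt hxn.le]
        exact mul_lt_of_lt_one_left hn' (lt_of_le_of_ne hx.2 hx1)
      have hc := negBinomCoeff_pos hγ0 ⌊x * n⌋₊
      rw [Real.norm_eq_abs, abs_mul, abs_of_pos (by positivity)]
      gcongr
      · have := hx.1
        positivity
      · rw [← neg_sub 1 (2 - β), Real.rpow_neg hx.1.le, ← one_div,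
          le_div_iff₀ (Real.rpow_pos_of_pos hx.1 _)]
        calc _ = negBinomCoeff (2 - β) ⌊x * n⌋₊ * (x * n) ^ (1 - (2 - β)) := by
              rw [Real.mul_rpow hx.1.le hn'.le]
              ring
          _ ≤ negBinomCoeff (2 - β) ⌊x * n⌋₊ * ((⌊x * n⌋₊ : ℝ) + 1) ^ (1 - (2 - β)) := by
              gcongr
              exact (Nat.lt_floor_add_one _).le
          _ ≤ 1 := negBinomCoeff_mul_rpow_le hγ0 hγ1 _
      · exact abs_secondQuotient_le hg2 hg0 hg0' ht hM hfl
    · exact ((intervalIntegral.intervalIntegrable_rpow' (by linarith)).const_mul _).mul_const _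
    · filter_upwards [Measure.ae_ne volume (1 : ℝ)] with x hx1 hx
      rw [Set.uIoc_of_le zero_le_one] at hx
      exact ((tendsto_rpow_mul_negBinomCoeff_floor hγ0 hx.1).const_mul _).mul
        (tendsto_secondQuotient_floor hg2 ht ⟨hx.1, lt_of_le_of_ne hx.2 hx1⟩)
  refine hdom.congr' ?_
  filter_upwards [eventually_gt_atTop 0] with n hn
  rw [rpow_mul_sum_eq_sum_secondQuotient ht hg0 hn]
  exact integral_floor_mul hn fun m => t ^ (2 - β) * ((n : ℝ) ^ (1 - (2 - β)) *
    negBinomCoeff (2 - β) m) * secondQuotient g t n m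
end
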